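/- arXiv:1108.5949 — 7 statements merged into one kernel-verified Lean document; each statement's English description precedes it below -/
import Mathlib

section
/- For every integer k ≥ 1, let L_k be the graph of order n = 4k + 6 with special 2-paths a_1 v_1 v_2 v_3 c_1 and b_k u_1 u_2 u_3 d_k, and let w ∈ {v_1, v_2, v_3}. Then γt(L_k − w) = n/2 = 2k + 3. -/
open SimpleGraph

/-- The total domination number of a finite simple graph `G`: the minimum size of a set `S`
of vertices such that every vertex of `G` has a neighbor in `S`. -/
noncomputable def totalDominationNumber {V : Type*} [Fintype V] (G : SimpleGraph V) : ℕ :=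
  sInf {n | ∃ S : Finset V, S.card = n ∧ ∀ v : V, ∃ u ∈ S, G.Adj v u}

/-- The almost total domination number of `G` with respect to `v`: the minimum size of a set
`S` with `v ∈ S`, `v` having no neighbor in `S`, and every vertex other than `v` having a
neighbor in `S`. -/
noncomputable def almostTotalDominationNumber {V : Type*} [Fintype V] (G : SimpleGraph V)
    (v : V) : ℕ :=
  sInf {n | ∃ S : Finset V, S.card = n ∧ v ∈ S ∧ (∀ u ∈ S, ¬ G.Adj v u) ∧
    ∀ w : V, w ≠ v → ∃ u ∈ S, G.Adj w u}

/-- The graph obtained from `G` by deleting the vertex `v` and all incident edges. -/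
def deleteVert {V : Type*} (G : SimpleGraph V) (v : V) : SimpleGraph {w : V // w ≠ v} :=
  G.induce {w : V | w ≠ v}

/-- The cycle `C_n` on vertex set `Fin n`. -/
def cycleG (n : ℕ) : SimpleGraph (Fin n) :=
  SimpleGraph.fromRel (fun p q => (q : ℕ) = ((p : ℕ) + 1) % n)

/-- The 2-corona `C_k ∘ P_2` of the cycle `C_k`.  Vertex `(0, i)` is the cycle vertex `x_i`,
`(1, i)` is `x_i'` and `(2, i)` is `x_i''`, with pendant path `x_i x_i' x_i''`. -/
def coronaRel (k : ℕ) (p q : Fin 3 × Fin k) : Prop :=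
  (p.1 = 0 ∧ q.1 = 0 ∧ (q.2 : ℕ) = ((p.2 : ℕ) + 1) % k) ∨
  (p.1 = 0 ∧ q.1 = 1 ∧ p.2 = q.2) ∨
  (p.1 = 1 ∧ q.1 = 2 ∧ p.2 = q.2)

def coronaGraph (k : ℕ) : SimpleGraph (Fin 3 × Fin k) :=
  SimpleGraph.fromRel (coronaRel k)

/-- The edges of `G_k` common to `G_k`, `H_k`, `F_k`, `L_k` (0-indexed: `(0,i) = a_{i+1}`,
`(1,i) = b_{i+1}`, `(2,i) = c_{i+1}`, `(3,i) = d_{i+1}`): the two paths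
`a_1 b_1 a_2 b_2 … a_k b_k` and `c_1 d_1 c_2 d_2 … c_k d_k`, and the edges `a_i d_i`,
`b_i c_i`. -/
def gkBase (k : ℕ) (p q : Fin 4 × Fin k) : Prop :=
  (p.1 = 0 ∧ q.1 = 1 ∧ p.2 = q.2) ∨
  (p.1 = 1 ∧ q.1 = 0 ∧ (p.2 : ℕ) + 1 = (q.2 : ℕ)) ∨
  (p.1 = 2 ∧ q.1 = 3 ∧ p.2 = q.2) ∨
  (p.1 = 3 ∧ q.1 = 2 ∧ (p.2 : ℕ) + 1 = (q.2 : ℕ)) ∨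
  (p.1 = 0 ∧ q.1 = 3 ∧ p.2 = q.2) ∨
  (p.1 = 1 ∧ q.1 = 2 ∧ p.2 = q.2)

/-- The cubic graph `G_k`: the base edges together with `a_1 c_1` and `b_k d_k`. -/
def gkRel (k : ℕ) (p q : Fin 4 × Fin k) : Prop :=
  gkBase k p q ∨
  (p.1 = 0 ∧ q.1 = 2 ∧ (p.2 : ℕ) = 0 ∧ (q.2 : ℕ) = 0) ∨
  (p.1 = 1 ∧ q.1 = 3 ∧ (p.2 : ℕ) = k - 1 ∧ (q.2 : ℕ) = k - 1)

def GkGraph (k : ℕ) : SimpleGraph (Fin 4 × Fin k) :=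
  SimpleGraph.fromRel (gkRel k)

/-- The cubic graph `H_k`: the base edges together with `a_1 b_k` and `c_1 d_k`. -/
def hkRel (k : ℕ) (p q : Fin 4 × Fin k) : Prop :=
  gkBase k p q ∨
  (p.1 = 0 ∧ q.1 = 1 ∧ (p.2 : ℕ) = 0 ∧ (q.2 : ℕ) = k - 1) ∨
  (p.1 = 2 ∧ q.1 = 3 ∧ (p.2 : ℕ) = 0 ∧ (q.2 : ℕ) = k - 1)

def HkGraph (k : ℕ) : SimpleGraph (Fin 4 × Fin k) :=
  SimpleGraph.fromRel (hkRel k)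

/-- Vertices of `F_k`: the vertices of `G_k` together with `v_1, v_2, v_3`
(encoded `Sum.inr 0`, `Sum.inr 1`, `Sum.inr 2`). -/
abbrev FkVert (k : ℕ) := (Fin 4 × Fin k) ⊕ Fin 3

/-- `F_k` is obtained from `G_k` by subdividing the edge `a_1 c_1` three times,
giving the path `a_1 v_1 v_2 v_3 c_1`. -/
def fkRel (k : ℕ) (p q : FkVert k) : Prop :=
  match p, q with
  | Sum.inl p, Sum.inl q =>
      gkBase k p q ∨
      (p.1 = 1 ∧ q.1 = 3 ∧ (p.2 : ℕ) = k - 1 ∧ (q.2 : ℕ) = k - 1)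
  | Sum.inl p, Sum.inr j =>
      (p.1 = 0 ∧ (p.2 : ℕ) = 0 ∧ j = 0) ∨ (p.1 = 2 ∧ (p.2 : ℕ) = 0 ∧ j = 2)
  | Sum.inr i, Sum.inr j => (j : ℕ) = (i : ℕ) + 1
  | Sum.inr _, Sum.inl _ => False

def FkGraph (k : ℕ) : SimpleGraph (FkVert k) :=
  SimpleGraph.fromRel (fkRel k)

/-- Vertices of `L_k`: the vertices of `G_k` together with `v_1, v_2, v_3`
(encoded `Sum.inr (0, j)`) and `u_1, u_2, u_3` (encoded `Sum.inr (1, j)`). -/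
abbrev LkVert (k : ℕ) := (Fin 4 × Fin k) ⊕ (Fin 2 × Fin 3)

/-- `L_k` is obtained from `G_k` by subdividing the edge `a_1 c_1` three times (path
`a_1 v_1 v_2 v_3 c_1`) and the edge `b_k d_k` three times (path `b_k u_1 u_2 u_3 d_k`). -/
def lkRel (k : ℕ) (p q : LkVert k) : Prop :=
  match p, q with
  | Sum.inl p, Sum.inl q => gkBase k p q
  | Sum.inl p, Sum.inr j =>
      (p.1 = 0 ∧ (p.2 : ℕ) = 0 ∧ j = ((0 : Fin 2), (0 : Fin 3))) ∨
      (p.1 = 2 ∧ (p.2 : ℕ) = 0 ∧ j = ((0 : Fin 2), (2 : Fin 3))) ∨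
      (p.1 = 1 ∧ (p.2 : ℕ) = k - 1 ∧ j = ((1 : Fin 2), (0 : Fin 3))) ∨
      (p.1 = 3 ∧ (p.2 : ℕ) = k - 1 ∧ j = ((1 : Fin 2), (2 : Fin 3)))
  | Sum.inr i, Sum.inr j => i.1 = j.1 ∧ (j.2 : ℕ) = (i.2 : ℕ) + 1
  | Sum.inr _, Sum.inl _ => False

def LkGraph (k : ℕ) : SimpleGraph (LkVert k) :=
  SimpleGraph.fromRel (lkRel k)

/-- The generalized Petersen graph `GP(8,3)` of order 16: `(0, i) = u_i`, `(1, i) = w_i`. -/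
def gpRel (p q : Fin 2 × Fin 8) : Prop :=
  (p.1 = 0 ∧ q.1 = 0 ∧ (q.2 : ℕ) = ((p.2 : ℕ) + 1) % 8) ∨
  (p.1 = 0 ∧ q.1 = 1 ∧ p.2 = q.2) ∨
  (p.1 = 1 ∧ q.1 = 1 ∧ (q.2 : ℕ) = ((p.2 : ℕ) + 3) % 8)

def GP16 : SimpleGraph (Fin 2 × Fin 8) :=
  SimpleGraph.fromRel gpRel

/-- A vertex set avoiding `w` and totally dominating all other vertices of `G`. -/
def TotallyDominatesOff {V : Type*} (G : SimpleGraph V) (w : V) (T : Finset V) : Prop :=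
  w ∉ T ∧ ∀ v, v ≠ w → ∃ u ∈ T, G.Adj v u

theorem totalDominationNumber_deleteVert_eq {V : Type*} [Fintype V] [DecidableEq V]
    {G : SimpleGraph V} {w : V} {n : ℕ}
    (upper : ∃ T, TotallyDominatesOff G w T ∧ T.card ≤ n)
    (lower : ∀ T, TotallyDominatesOff G w T → n ≤ T.card) :
    totalDominationNumber (deleteVert G w) = n := by
  obtain ⟨T, ⟨hwT, hT⟩, hcard⟩ := upper
  have hmem : T.card ∈ {n | ∃ S : Finset {v // v ≠ w}, S.card = n ∧
      ∀ v, ∃ u ∈ S, (deleteVert G w).Adj v u} := by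
    refine ⟨T.subtype (· ≠ w), ?_, fun v => ?_⟩
    · rw [Finset.card_subtype, Finset.filter_true_of_mem]
      rintro x hx rfl
      exact hwT hx
    · obtain ⟨u, hu, huv⟩ := hT v v.2
      refine ⟨⟨u, ?_⟩, by simpa using hu, huv⟩
      rintro rfl
      exact hwT hu
  refine le_antisymm ((Nat.sInf_le hmem).trans hcard) (le_csInf ⟨_, hmem⟩ ?_)
  rintro _ ⟨S, rfl, hS⟩
  rw [← Finset.card_map (Function.Embedding.subtype _)]
  refine lower _ ⟨by simp, fun v hv => ?_⟩
  obtain ⟨u, hu, huv⟩ := hS ⟨v, hv⟩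
  exact ⟨u, Finset.mem_map_of_mem _ hu, huv⟩

theorem add_le_sum_range_of_forward (f g : ℕ → ℕ) (e m : ℕ)
    (hf : ∀ i < m, 1 ≤ f i + g i + f (i + 1)) (hg : ∀ i < m, 1 ≤ f i + g i + g (i + 1))
    (h0 : e ≤ f 0 + g 0) (h0' : 1 ≤ f 0 + g 0 → e + 1 ≤ f 0 + g 0) :
    m + e ≤ ∑ i ∈ Finset.range (m + 1), (f i + g i) ∧
      (1 ≤ f m + g m → m + e + 1 ≤ ∑ i ∈ Finset.range (m + 1), (f i + g i)) := by
  induction m with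
  | zero => simpa using ⟨h0, h0'⟩
  | succ m ih =>
    have ih := ih (fun i hi => hf i (by omega)) (fun i hi => hg i (by omega))
    have h1 := hf m (by omega)
    have h2 := hg m (by omega)
    rw [Finset.sum_range_succ]
    omega

theorem add_le_sum_range_of_backward (f g : ℕ → ℕ) (c e m : ℕ)
    (hf : ∀ i < m, 1 ≤ f (i + 1) + g (i + 1) + f i)
    (hg : ∀ i < m, 1 ≤ f (i + 1) + g (i + 1) + g i)
    (h0 : e ≤ c + f 0 + g 0) (h0' : 1 ≤ f 0 → 1 ≤ g 0 → e + 1 ≤ c + f 0 + g 0) :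
    m + e ≤ c + ∑ i ∈ Finset.range (m + 1), (f i + g i) ∧
      (1 ≤ f m → 1 ≤ g m → m + e + 1 ≤ c + ∑ i ∈ Finset.range (m + 1), (f i + g i)) := by
  induction m with
  | zero =>
    rw [add_assoc] at h0 h0'
    simpa using ⟨h0, h0'⟩
  | succ m ih =>
    have ih := ih (fun i hi => hf i (by omega)) (fun i hi => hg i (by omega))
    have h1 := hf m (by omega)
    have h2 := hg m (by omega)
    rw [Finset.sum_range_succ]
    omega

section Neighbors

variable {k : ℕ} {i : Fin k} {u : LkVert k}

theorem LkGraph_adj_a (h : (LkGraph k).Adj (Sum.inl (0, i)) u) :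
    u = Sum.inl (1, i) ∨ u = Sum.inl (3, i) ∨
      (∃ i' : Fin k, (i' : ℕ) + 1 = i ∧ u = Sum.inl (1, i')) ∨
      ((i : ℕ) = 0 ∧ u = Sum.inr (0, 0)) := by
  rcases u with ⟨p, l⟩ | q
  · fin_cases p <;> simp_all [LkGraph, lkRel, gkBase, eq_comm]
  · simp_all [LkGraph, lkRel]

theorem LkGraph_adj_b (h : (LkGraph k).Adj (Sum.inl (1, i)) u) :
    u = Sum.inl (0, i) ∨ u = Sum.inl (2, i) ∨
      (∃ i' : Fin k, (i : ℕ) + 1 = i' ∧ u = Sum.inl (0, i')) ∨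
      ((i : ℕ) = k - 1 ∧ u = Sum.inr (1, 0)) := by
  rcases u with ⟨p, l⟩ | q
  · fin_cases p <;> simp_all [LkGraph, lkRel, gkBase, eq_comm] <;> tauto
  · simp_all [LkGraph, lkRel]

theorem LkGraph_adj_c (h : (LkGraph k).Adj (Sum.inl (2, i)) u) :
    u = Sum.inl (1, i) ∨ u = Sum.inl (3, i) ∨
      (∃ i' : Fin k, (i' : ℕ) + 1 = i ∧ u = Sum.inl (3, i')) ∨
      ((i : ℕ) = 0 ∧ u = Sum.inr (0, 2)) := by
  rcases u with ⟨p, l⟩ | q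
  · fin_cases p <;> simp_all [LkGraph, lkRel, gkBase, eq_comm]
  · simp_all [LkGraph, lkRel]

theorem LkGraph_adj_d (h : (LkGraph k).Adj (Sum.inl (3, i)) u) :
    u = Sum.inl (0, i) ∨ u = Sum.inl (2, i) ∨
      (∃ i' : Fin k, (i : ℕ) + 1 = i' ∧ u = Sum.inl (2, i')) ∨
      ((i : ℕ) = k - 1 ∧ u = Sum.inr (1, 2)) := by
  rcases u with ⟨p, l⟩ | q
  · fin_cases p <;> simp_all [LkGraph, lkRel, gkBase, eq_comm] <;> tauto
  · simp_all [LkGraph, lkRel]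

theorem LkGraph_adj_v₁ (h : (LkGraph k).Adj (Sum.inr (0, 0)) u) :
    u = Sum.inr (0, 1) ∨ ∃ i : Fin k, (i : ℕ) = 0 ∧ u = Sum.inl (0, i) := by
  rcases u with ⟨p, l⟩ | ⟨q, l⟩
  · fin_cases p <;> simp_all [LkGraph, lkRel]
  · fin_cases q <;> fin_cases l <;> simp_all [LkGraph, lkRel]

theorem LkGraph_adj_v₃ (h : (LkGraph k).Adj (Sum.inr (0, 2)) u) :
    u = Sum.inr (0, 1) ∨ ∃ i : Fin k, (i : ℕ) = 0 ∧ u = Sum.inl (2, i) := by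
  rcases u with ⟨p, l⟩ | ⟨q, l⟩
  · fin_cases p <;> simp_all [LkGraph, lkRel]
  · fin_cases q <;> fin_cases l <;> simp_all [LkGraph, lkRel]

theorem LkGraph_adj_u₁ (h : (LkGraph k).Adj (Sum.inr (1, 0)) u) :
    u = Sum.inr (1, 1) ∨ ∃ i : Fin k, (i : ℕ) = k - 1 ∧ u = Sum.inl (1, i) := by
  rcases u with ⟨p, l⟩ | ⟨q, l⟩
  · fin_cases p <;> simp_all [LkGraph, lkRel]
  · fin_cases q <;> fin_cases l <;> simp_all [LkGraph, lkRel]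

theorem LkGraph_adj_u₃ (h : (LkGraph k).Adj (Sum.inr (1, 2)) u) :
    u = Sum.inr (1, 1) ∨ ∃ i : Fin k, (i : ℕ) = k - 1 ∧ u = Sum.inl (3, i) := by
  rcases u with ⟨p, l⟩ | ⟨q, l⟩
  · fin_cases p <;> simp_all [LkGraph, lkRel]
  · fin_cases q <;> fin_cases l <;> simp_all [LkGraph, lkRel]

theorem LkGraph_adj_middle {t : Fin 2} (h : (LkGraph k).Adj (Sum.inr (t, 1)) u) :
    u = Sum.inr (t, 0) ∨ u = Sum.inr (t, 2) := by
  rcases u with ⟨p, l⟩ | ⟨q, l⟩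
  · simp_all [LkGraph, lkRel]
  · fin_cases t <;> fin_cases q <;> fin_cases l <;> simp_all [LkGraph, lkRel]

end Neighbors

/-- Indicator of the `i`-th vertex of row `p` belonging to `T`, zero when `i ≥ k`. -/
def rowIndicator {k : ℕ} (T : Finset (LkVert k)) (p : Fin 4) (i : ℕ) : ℕ :=
  if h : i < k then if Sum.inl (p, ⟨i, h⟩) ∈ T then 1 else 0 else 0

/-- Indicator of a subdivision vertex belonging to `T`. -/
def subdivIndicator {k : ℕ} (T : Finset (LkVert k)) (q : Fin 2 × Fin 3) : ℕ :=
  if Sum.inr q ∈ T then 1 else 0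

theorem rowIndicator_pos {k : ℕ} {T : Finset (LkVert k)} {p : Fin 4} {i : Fin k}
    (h : Sum.inl (p, i) ∈ T) : 1 ≤ rowIndicator T p i := by
  simp [rowIndicator, h]

theorem subdivIndicator_pos {k : ℕ} {T : Finset (LkVert k)} {q : Fin 2 × Fin 3}
    (h : Sum.inr q ∈ T) : 1 ≤ subdivIndicator T q := by
  simp [subdivIndicator, h]

theorem card_eq_sum_indicators {k : ℕ} (T : Finset (LkVert k)) :
    T.card = (∑ i ∈ Finset.range k, (rowIndicator T 0 i + rowIndicator T 2 i)) +
      (∑ i ∈ Finset.range k, (rowIndicator T 1 i + rowIndicator T 3 i)) +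
      (subdivIndicator T (0, 0) + subdivIndicator T (0, 1) + subdivIndicator T (0, 2) +
        subdivIndicator T (1, 0) + subdivIndicator T (1, 1) + subdivIndicator T (1, 2)) := by
  have h : T.card = ∑ v : LkVert k, if v ∈ T then 1 else 0 := by simp
  rw [h, Fintype.sum_sum_type, Fintype.sum_prod_type, Fintype.sum_prod_type, Fin.sum_univ_four,
    Fin.sum_univ_two, Fin.sum_univ_three, Fin.sum_univ_three]
  simp only [Finset.sum_range, Finset.sum_add_distrib, rowIndicator, subdivIndicator, Fin.is_lt,
    dite_true, Fin.eta]
  ring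

theorem two_mul_add_le_card_of_totallyDominatesOff {m : ℕ} {j : Fin 3}
    {T : Finset (LkVert (m + 1))}
    (hT : TotallyDominatesOff (LkGraph (m + 1)) (Sum.inr (0, j)) T) :
    2 * (m + 1) + 3 ≤ T.card := by
  obtain ⟨hw, hdom⟩ := hT
  have ha : ∀ i < m, 1 ≤ rowIndicator T 1 (i + 1) + rowIndicator T 3 (i + 1) +
      rowIndicator T 1 i := by
    intro i hi
    obtain ⟨u, hu, huv⟩ := hdom (Sum.inl (0, ⟨i + 1, by omega⟩)) (by simp)
    rcases LkGraph_adj_a huv with rfl | rfl | ⟨l, hl, rfl⟩ | ⟨hl, rfl⟩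
    · have := rowIndicator_pos hu; dsimp at this; omega
    · have := rowIndicator_pos hu; dsimp at this; omega
    · have := rowIndicator_pos hu
      obtain rfl : (l : ℕ) = i := by simpa using hl
      omega
    · simp at hl
  have hc : ∀ i < m, 1 ≤ rowIndicator T 1 (i + 1) + rowIndicator T 3 (i + 1) +
      rowIndicator T 3 i := by
    intro i hi
    obtain ⟨u, hu, huv⟩ := hdom (Sum.inl (2, ⟨i + 1, by omega⟩)) (by simp)
    rcases LkGraph_adj_c huv with rfl | rfl | ⟨l, hl, rfl⟩ | ⟨hl, rfl⟩
    · have := rowIndicator_pos hu; dsimp at this; omega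
    · have := rowIndicator_pos hu; dsimp at this; omega
    · have := rowIndicator_pos hu
      obtain rfl : (l : ℕ) = i := by simpa using hl
      omega
    · simp at hl
  have hb : ∀ i < m, 1 ≤ rowIndicator T 0 i + rowIndicator T 2 i +
      rowIndicator T 0 (i + 1) := by
    intro i hi
    obtain ⟨u, hu, huv⟩ := hdom (Sum.inl (1, ⟨i, by omega⟩)) (by simp)
    rcases LkGraph_adj_b huv with rfl | rfl | ⟨l, hl, rfl⟩ | ⟨hl, rfl⟩
    · have := rowIndicator_pos hu; dsimp at this; omega
    · have := rowIndicator_pos hu; dsimp at this; omega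
    · have := rowIndicator_pos hu
      rw [← hl] at this
      dsimp at this
      omega
    · simp at hl; omega
  have hd : ∀ i < m, 1 ≤ rowIndicator T 0 i + rowIndicator T 2 i +
      rowIndicator T 2 (i + 1) := by
    intro i hi
    obtain ⟨u, hu, huv⟩ := hdom (Sum.inl (3, ⟨i, by omega⟩)) (by simp)
    rcases LkGraph_adj_d huv with rfl | rfl | ⟨l, hl, rfl⟩ | ⟨hl, rfl⟩
    · have := rowIndicator_pos hu; dsimp at this; omega
    · have := rowIndicator_pos hu; dsimp at this; omega
    · have := rowIndicator_pos hu
      rw [← hl] at this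
      dsimp at this
      omega
    · simp at hl; omega
  have ha₀ : 1 ≤ rowIndicator T 1 0 + rowIndicator T 3 0 + subdivIndicator T (0, 0) := by
    obtain ⟨u, hu, huv⟩ := hdom (Sum.inl (0, ⟨0, by omega⟩)) (by simp)
    rcases LkGraph_adj_a huv with rfl | rfl | ⟨l, hl, rfl⟩ | ⟨hl, rfl⟩
    · have := rowIndicator_pos hu; dsimp at this; omega
    · have := rowIndicator_pos hu; dsimp at this; omega
    · simp at hl
    · have := subdivIndicator_pos hu; omega
  have hc₀ : 1 ≤ rowIndicator T 1 0 + rowIndicator T 3 0 + subdivIndicator T (0, 2) := by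
    obtain ⟨u, hu, huv⟩ := hdom (Sum.inl (2, ⟨0, by omega⟩)) (by simp)
    rcases LkGraph_adj_c huv with rfl | rfl | ⟨l, hl, rfl⟩ | ⟨hl, rfl⟩
    · have := rowIndicator_pos hu; dsimp at this; omega
    · have := rowIndicator_pos hu; dsimp at this; omega
    · simp at hl
    · have := subdivIndicator_pos hu; omega
  have hbm : 1 ≤ rowIndicator T 0 m + rowIndicator T 2 m + subdivIndicator T (1, 0) := by
    obtain ⟨u, hu, huv⟩ := hdom (Sum.inl (1, ⟨m, by omega⟩)) (by simp)
    rcases LkGraph_adj_b huv with rfl | rfl | ⟨l, hl, rfl⟩ | ⟨hl, rfl⟩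
    · have := rowIndicator_pos hu; dsimp at this; omega
    · have := rowIndicator_pos hu; dsimp at this; omega
    · dsimp at hl; omega
    · have := subdivIndicator_pos hu; omega
  have hdm : 1 ≤ rowIndicator T 0 m + rowIndicator T 2 m + subdivIndicator T (1, 2) := by
    obtain ⟨u, hu, huv⟩ := hdom (Sum.inl (3, ⟨m, by omega⟩)) (by simp)
    rcases LkGraph_adj_d huv with rfl | rfl | ⟨l, hl, rfl⟩ | ⟨hl, rfl⟩
    · have := rowIndicator_pos hu; dsimp at this; omega
    · have := rowIndicator_pos hu; dsimp at this; omega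
    · dsimp at hl; omega
    · have := subdivIndicator_pos hu; omega
  have hu₁ : 1 ≤ subdivIndicator T (1, 1) + rowIndicator T 1 m := by
    obtain ⟨u, hu, huv⟩ := hdom (Sum.inr (1, 0)) (by simp)
    rcases LkGraph_adj_u₁ huv with rfl | ⟨l, hl, rfl⟩
    · have := subdivIndicator_pos hu; omega
    · have := rowIndicator_pos hu; rw [hl] at this; dsimp at this; omega
  have hu₃ : 1 ≤ subdivIndicator T (1, 1) + rowIndicator T 3 m := by
    obtain ⟨u, hu, huv⟩ := hdom (Sum.inr (1, 2)) (by simp)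
    rcases LkGraph_adj_u₃ huv with rfl | ⟨l, hl, rfl⟩
    · have := subdivIndicator_pos hu; omega
    · have := rowIndicator_pos hu; rw [hl] at this; dsimp at this; omega
  have hu₂ : 1 ≤ subdivIndicator T (1, 0) + subdivIndicator T (1, 2) := by
    obtain ⟨u, hu, huv⟩ := hdom (Sum.inr (1, 1)) (by simp)
    rcases LkGraph_adj_middle huv with rfl | rfl
    · have := subdivIndicator_pos hu; omega
    · have := subdivIndicator_pos hu; omega
  have hv₁ : j ≠ 0 → 1 ≤ subdivIndicator T (0, 1) + rowIndicator T 0 0 := by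
    intro hj
    obtain ⟨u, hu, huv⟩ := hdom (Sum.inr (0, 0)) (by simpa using hj.symm)
    rcases LkGraph_adj_v₁ huv with rfl | ⟨l, hl, rfl⟩
    · have := subdivIndicator_pos hu; omega
    · have := rowIndicator_pos hu; rw [hl] at this; omega
  have hv₃ : j ≠ 2 → 1 ≤ subdivIndicator T (0, 1) + rowIndicator T 2 0 := by
    intro hj
    obtain ⟨u, hu, huv⟩ := hdom (Sum.inr (0, 2)) (by simpa using hj.symm)
    rcases LkGraph_adj_v₃ huv with rfl | ⟨l, hl, rfl⟩
    · have := subdivIndicator_pos hu; omega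
    · have := rowIndicator_pos hu; rw [hl] at this; omega
  have hv₂ : j ≠ 1 → 1 ≤ subdivIndicator T (0, 0) + subdivIndicator T (0, 2) := by
    intro hj
    obtain ⟨u, hu, huv⟩ := hdom (Sum.inr (0, 1)) (by simpa using hj.symm)
    rcases LkGraph_adj_middle huv with rfl | rfl
    · have := subdivIndicator_pos hu; omega
    · have := subdivIndicator_pos hu; omega
  have hj₀ : subdivIndicator T (0, j) = 0 := by simp [subdivIndicator, hw]
  rw [card_eq_sum_indicators]
  by_cases hj : j = 1
  · subst hj
    have hv₁ := hv₁ (by decide)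
    have hv₃ := hv₃ (by decide)
    have hX := add_le_sum_range_of_forward _ _ 1 m hb hd (by omega) (by omega)
    have hY := add_le_sum_range_of_backward _ _
      (subdivIndicator T (0, 0) + subdivIndicator T (0, 2)) 1 m ha hc (by omega) (by omega)
    omega
  · have hv₂ := hv₂ hj
    have hX := add_le_sum_range_of_forward _ _ 0 m hb hd (by omega) (by omega)
    have hY := add_le_sum_range_of_backward _ _
      (subdivIndicator T (0, 0) + subdivIndicator T (0, 2)) 2 m ha hc
      (by fin_cases j <;> simp_all <;> omega) (by omega)
    omega

/-- The rows `p` and `b`, the vertices `u_1` and `u_2`, and one extra vertex `x`. -/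
def twoRowsSet (k : ℕ) (p : Fin 4) (x : LkVert k) : Finset (LkVert k) :=
  Finset.univ.image (fun i => Sum.inl (p, i)) ∪ Finset.univ.image (fun i => Sum.inl (1, i)) ∪
    {Sum.inr (1, 0), Sum.inr (1, 1), x}

theorem card_twoRowsSet_le (k : ℕ) (p : Fin 4) (x : LkVert k) :
    (twoRowsSet k p x).card ≤ 2 * k + 3 := by
  have h (q : Fin 4) :
      (Finset.univ.image (fun i : Fin k => (Sum.inl (q, i) : LkVert k))).card ≤ k :=
    Finset.card_image_le.trans (by simp)
  have h₃ := Finset.card_le_three (a := (Sum.inr (1, 0) : LkVert k)) (b := Sum.inr (1, 1)) (c := x)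
  have h₁ := Finset.card_union_le
    (Finset.univ.image (fun i : Fin k => (Sum.inl (p, i) : LkVert k)) ∪
      Finset.univ.image (fun i : Fin k => (Sum.inl (1, i) : LkVert k)))
    {Sum.inr (1, 0), Sum.inr (1, 1), x}
  have h₂ := Finset.card_union_le
    (Finset.univ.image (fun i : Fin k => (Sum.inl (p, i) : LkVert k)))
    (Finset.univ.image (fun i : Fin k => (Sum.inl (1, i) : LkVert k)))
  have := h p
  have := h 1
  unfold twoRowsSet
  omega

theorem totallyDominatesOff_twoRowsSet {k : ℕ} {p : Fin 4} {x : LkVert k} {j : Fin 3}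
    (hp : p = 0 ∨ p = 2) (hx : x ≠ Sum.inr (0, j))
    (hv : ∀ t, t ≠ j → ∃ u ∈ twoRowsSet k p x, (LkGraph k).Adj (Sum.inr (0, t)) u) :
    TotallyDominatesOff (LkGraph k) (Sum.inr (0, j)) (twoRowsSet k p x) := by
  have hrow (i : Fin k) : Sum.inl (p, i) ∈ twoRowsSet k p x := by simp [twoRowsSet]
  have hb (i : Fin k) : Sum.inl (1, i) ∈ twoRowsSet k p x := by simp [twoRowsSet]
  have hu₁ : Sum.inr (1, 0) ∈ twoRowsSet k p x := by simp [twoRowsSet]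
  have hu₂ : Sum.inr (1, 1) ∈ twoRowsSet k p x := by simp [twoRowsSet]
  refine ⟨by simp [twoRowsSet, hx.symm], ?_⟩
  rintro (⟨q, i⟩ | ⟨q, t⟩) h
  · fin_cases q
    · exact ⟨_, hb i, by simp [LkGraph, lkRel, gkBase]⟩
    · exact ⟨_, hrow i, by rcases hp with rfl | rfl <;> simp [LkGraph, lkRel, gkBase]⟩
    · exact ⟨_, hb i, by simp [LkGraph, lkRel, gkBase]⟩
    · exact ⟨_, hrow i, by rcases hp with rfl | rfl <;> simp [LkGraph, lkRel, gkBase]⟩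
  · fin_cases q
    · exact hv t (by rintro rfl; exact h rfl)
    · fin_cases t
      · exact ⟨_, hu₂, by simp [LkGraph, lkRel]⟩
      · exact ⟨_, hu₁, by simp [LkGraph, lkRel]⟩
      · exact ⟨_, hu₂, by simp [LkGraph, lkRel]⟩

theorem exists_totallyDominatesOff_card_le (m : ℕ) (j : Fin 3) :
    ∃ T, TotallyDominatesOff (LkGraph (m + 1)) (Sum.inr (0, j)) T ∧
      T.card ≤ 2 * (m + 1) + 3 := by
  fin_cases j
  · refine ⟨_, totallyDominatesOff_twoRowsSet (p := 2) (x := Sum.inr (0, 2)) (by simp) (by simp) ?_,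
      card_twoRowsSet_le _ _ _⟩
    intro t ht
    fin_cases t
    · simp at ht
    · exact ⟨Sum.inr (0, 2), by simp [twoRowsSet], by simp [LkGraph, lkRel]⟩
    · exact ⟨Sum.inl (2, 0), by simp [twoRowsSet], by simp [LkGraph, lkRel]⟩
  · refine ⟨_, totallyDominatesOff_twoRowsSet (p := 0) (x := Sum.inl (2, 0)) (by simp) (by simp) ?_,
      card_twoRowsSet_le _ _ _⟩
    intro t ht
    fin_cases t
    · exact ⟨Sum.inl (0, 0), by simp [twoRowsSet], by simp [LkGraph, lkRel]⟩
    · simp at ht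
    · exact ⟨Sum.inl (2, 0), by simp [twoRowsSet], by simp [LkGraph, lkRel]⟩
  · refine ⟨_, totallyDominatesOff_twoRowsSet (p := 0) (x := Sum.inr (0, 0)) (by simp) (by simp) ?_,
      card_twoRowsSet_le _ _ _⟩
    intro t ht
    fin_cases t
    · exact ⟨Sum.inl (0, 0), by simp [twoRowsSet], by simp [LkGraph, lkRel]⟩
    · exact ⟨Sum.inr (0, 0), by simp [twoRowsSet], by simp [LkGraph, lkRel]⟩
    · simp at ht

/-- For `k ≥ 1`, deleting any vertex `w ∈ {v_1, v_2, v_3}` of the special 2-path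
`a_1 v_1 v_2 v_3 c_1` of `L_k` gives `γt(L_k − w) = n/2 = 2k + 3`. -/
theorem totalDominationNumber_Lk_deleteVert (k : ℕ) (hk : 1 ≤ k) (j : Fin 3) :
    totalDominationNumber (deleteVert (LkGraph k) (Sum.inr ((0 : Fin 2), j))) =
      2 * k + 3 := by
  obtain ⟨m, rfl⟩ := Nat.exists_eq_add_of_le' hk
  exact totalDominationNumber_deleteVert_eq (exists_totallyDominatesOff_card_le m j)
    (fun _ => two_mul_add_le_card_of_totallyDominatesOff)
end

section
/- For every integer k ≥ 1, let L_k be the graph of order n = 4k + 6 with special 2-paths a_1 v_1 v_2 v_3 c_1 and b_k u_1 u_2 u_3 d_k, and let w ∈ {v_1, v_2, v_3}. Then γta(L_k; w) = n/2 = 2k + 3. -/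
open SimpleGraph

/-- If every zero of `t` is preceded by a value at least `2`, then the partial sums of `t`
grow at least linearly. -/
lemma add_max_le_sum_range (t : ℕ → ℕ) (m : ℕ) (h0 : 1 ≤ t 0)
    (h : ∀ i < m, t (i + 1) = 0 → 2 ≤ t i) :
    m + max 1 (t m) ≤ ∑ i ∈ Finset.range (m + 1), t i := by
  induction m with
  | zero => simp [h0]
  | succ m ih =>
    have := ih fun i hi => h i (by omega)
    have := h m (by omega)
    rw [Finset.sum_range_succ]
    omega

/-- If every zero of `t` is followed by a value at least `2`, then the partial sums of `t`
grow at least linearly. -/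
lemma add_max_le_sum_range_reverse (t : ℕ → ℕ) (m : ℕ) (hm : 1 ≤ t m)
    (h : ∀ i < m, t i = 0 → 2 ≤ t (i + 1)) :
    m + max 1 (t 0) ≤ ∑ i ∈ Finset.range (m + 1), t i := by
  have := add_max_le_sum_range (fun i => t (m - i)) m (by simpa using hm) fun i hi h0 => by
    have := h (m - (i + 1)) (by omega) h0
    rwa [show m - (i + 1) + 1 = m - i by omega] at this
  rw [← Finset.sum_range_reflect]
  simpa using this

section Indicators

variable {k : ℕ} (S : Finset (LkVert k))

/-- The indicator of `S` on the vertex `(c, i)` of the ladder, extended by zero. -/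
def ladderIndicator (c : Fin 4) (i : ℕ) : ℕ :=
  if h : i < k then if Sum.inl (c, ⟨i, h⟩) ∈ S then 1 else 0 else 0

/-- The indicator of `S` on the subdividing vertices. -/
def pathIndicator (s : Fin 2) (j : Fin 3) : ℕ :=
  if Sum.inr (s, j) ∈ S then 1 else 0

lemma ladderIndicator_of_mem {c : Fin 4} {i : Fin k} (h : Sum.inl (c, i) ∈ S) :
    ladderIndicator S c i = 1 := by
  simp [ladderIndicator, h]

lemma pathIndicator_of_mem {s : Fin 2} {j : Fin 3} (h : Sum.inr (s, j) ∈ S) :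
    pathIndicator S s j = 1 := by
  simp [pathIndicator, h]

lemma card_eq_sum_indicators_s11 : S.card =
    ∑ i ∈ Finset.range k, (ladderIndicator S 1 i + ladderIndicator S 3 i) +
    ∑ i ∈ Finset.range k, (ladderIndicator S 0 i + ladderIndicator S 2 i) +
    (pathIndicator S 0 0 + pathIndicator S 0 1 + pathIndicator S 0 2) +
    (pathIndicator S 1 0 + pathIndicator S 1 1 + pathIndicator S 1 2) := by
  have h1 : S.card = ∑ x : LkVert k, if x ∈ S then 1 else 0 := by simp
  have h2 (c : Fin 4) : ∑ i : Fin k, (if Sum.inl (c, i) ∈ S then 1 else 0) =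
      ∑ i ∈ Finset.range k, ladderIndicator S c i := by
    rw [Finset.sum_range]
    simp [ladderIndicator]
  rw [h1, Fintype.sum_sum_type, Fintype.sum_prod_type, Fintype.sum_prod_type]
  simp only [Fin.sum_univ_four, Fin.sum_univ_three, Fin.sum_univ_two, h2, Finset.sum_add_distrib]
  simp only [pathIndicator]
  omega

variable {S}

lemma ladder_fst_dominated {i : ℕ} (hi : i < k)
    (h : ∃ u ∈ S, (LkGraph k).Adj (Sum.inl (0, ⟨i, hi⟩)) u) :
    1 ≤ ladderIndicator S 1 i + ladderIndicator S 3 i +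
      if i = 0 then pathIndicator S 0 0 else ladderIndicator S 1 (i - 1) := by
  obtain ⟨⟨c, i'⟩ | ⟨s, j⟩, hu, hadj⟩ := h
  · have := ladderIndicator_of_mem S hu
    simp [LkGraph, lkRel, gkBase] at hadj
    grind
  · have := pathIndicator_of_mem S hu
    simp [LkGraph, lkRel] at hadj
    grind

lemma ladder_trd_dominated {i : ℕ} (hi : i < k)
    (h : ∃ u ∈ S, (LkGraph k).Adj (Sum.inl (2, ⟨i, hi⟩)) u) :
    1 ≤ ladderIndicator S 1 i + ladderIndicator S 3 i +
      if i = 0 then pathIndicator S 0 2 else ladderIndicator S 3 (i - 1) := by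
  obtain ⟨⟨c, i'⟩ | ⟨s, j⟩, hu, hadj⟩ := h
  · have := ladderIndicator_of_mem S hu
    simp [LkGraph, lkRel, gkBase] at hadj
    grind
  · have := pathIndicator_of_mem S hu
    simp [LkGraph, lkRel] at hadj
    grind

lemma ladder_snd_dominated {i : ℕ} (hi : i < k)
    (h : ∃ u ∈ S, (LkGraph k).Adj (Sum.inl (1, ⟨i, hi⟩)) u) :
    1 ≤ ladderIndicator S 0 i + ladderIndicator S 2 i +
      if i + 1 = k then pathIndicator S 1 0 else ladderIndicator S 0 (i + 1) := by
  obtain ⟨⟨c, i'⟩ | ⟨s, j⟩, hu, hadj⟩ := h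
  · have := ladderIndicator_of_mem S hu
    simp [LkGraph, lkRel, gkBase] at hadj
    grind
  · have := pathIndicator_of_mem S hu
    simp [LkGraph, lkRel] at hadj
    grind

lemma ladder_fth_dominated {i : ℕ} (hi : i < k)
    (h : ∃ u ∈ S, (LkGraph k).Adj (Sum.inl (3, ⟨i, hi⟩)) u) :
    1 ≤ ladderIndicator S 0 i + ladderIndicator S 2 i +
      if i + 1 = k then pathIndicator S 1 2 else ladderIndicator S 2 (i + 1) := by
  obtain ⟨⟨c, i'⟩ | ⟨s, j⟩, hu, hadj⟩ := h
  · have := ladderIndicator_of_mem S hu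
    simp [LkGraph, lkRel, gkBase] at hadj
    grind
  · have := pathIndicator_of_mem S hu
    simp [LkGraph, lkRel] at hadj
    grind

lemma path_fst_dominated {s : Fin 2} (h : ∃ u ∈ S, (LkGraph k).Adj (Sum.inr (s, 0)) u) :
    1 ≤ pathIndicator S s 1 +
      if s = 0 then ladderIndicator S 0 0 else ladderIndicator S 1 (k - 1) := by
  obtain ⟨⟨c, i'⟩ | ⟨s', j⟩, hu, hadj⟩ := h
  · have := ladderIndicator_of_mem S hu
    simp [LkGraph, lkRel] at hadj
    grind
  · have := pathIndicator_of_mem S hu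
    simp [LkGraph, lkRel] at hadj
    grind

lemma path_snd_dominated {s : Fin 2} (h : ∃ u ∈ S, (LkGraph k).Adj (Sum.inr (s, 1)) u) :
    1 ≤ pathIndicator S s 0 + pathIndicator S s 2 := by
  obtain ⟨⟨c, i'⟩ | ⟨s', j⟩, hu, hadj⟩ := h
  · simp [LkGraph, lkRel] at hadj
  · have := pathIndicator_of_mem S hu
    simp [LkGraph, lkRel] at hadj
    grind

lemma path_trd_dominated {s : Fin 2} (h : ∃ u ∈ S, (LkGraph k).Adj (Sum.inr (s, 2)) u) :
    1 ≤ pathIndicator S s 1 +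
      if s = 0 then ladderIndicator S 2 0 else ladderIndicator S 3 (k - 1) := by
  obtain ⟨⟨c, i'⟩ | ⟨s', j⟩, hu, hadj⟩ := h
  · have := ladderIndicator_of_mem S hu
    simp [LkGraph, lkRel] at hadj
    grind
  · have := pathIndicator_of_mem S hu
    simp [LkGraph, lkRel] at hadj
    grind

end Indicators

lemma le_card_of_almostTotalDominating {k : ℕ} (hk : 1 ≤ k) (j : Fin 3) (S : Finset (LkVert k))
    (hmem : Sum.inr (0, j) ∈ S) (hnot : ∀ u ∈ S, ¬ (LkGraph k).Adj (Sum.inr (0, j)) u)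
    (hdom : ∀ w : LkVert k, w ≠ Sum.inr (0, j) → ∃ u ∈ S, (LkGraph k).Adj w u) :
    2 * k + 3 ≤ S.card := by
  obtain ⟨k, rfl⟩ : ∃ n, k = n + 1 := ⟨k - 1, by omega⟩
  have ha (i) (hi : i < k + 1) := ladder_fst_dominated hi (hdom _ (by simp))
  have hb (i) (hi : i < k + 1) := ladder_snd_dominated hi (hdom _ (by simp))
  have hc (i) (hi : i < k + 1) := ladder_trd_dominated hi (hdom _ (by simp))
  have hd (i) (hi : i < k + 1) := ladder_fth_dominated hi (hdom _ (by simp))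
  have hu1 := path_fst_dominated (s := 1) (hdom _ (by simp))
  have hu2 := path_snd_dominated (s := 1) (hdom _ (by simp))
  have hu3 := path_trd_dominated (s := 1) (hdom _ (by simp))
  have hv2 (hj : j ≠ 1) := path_snd_dominated (s := 0) (hdom _ (by simpa using hj.symm))
  have hw := pathIndicator_of_mem S hmem
  simp only [Nat.add_sub_cancel, one_ne_zero, if_false] at hu1 hu3
  have hcard := card_eq_sum_indicators_s11 S
  set g := ladderIndicator S
  set p := pathIndicator S
  -- the vertices `b_i`, `d_i`, starting at `v_1`, `v_3`
  have hB : k + 3 ≤ ∑ i ∈ Finset.range (k + 1), (g 1 i + g 3 i) + (p 0 0 + p 0 2) + p 1 1 ∨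
      j = 1 ∧ k + 2 ≤ ∑ i ∈ Finset.range (k + 1), (g 1 i + g 3 i) + p 1 1 := by
    by_cases hj : j = 1
    · refine .inr ⟨hj, ?_⟩
      subst hj
      have h0 : p 0 0 = 0 := by
        simp only [p, pathIndicator, ite_eq_right_iff, one_ne_zero, imp_false]
        exact fun h => hnot _ h (by simp [LkGraph, lkRel])
      have := add_max_le_sum_range (fun i => g 1 i + g 3 i) k
        (by simpa [h0] using ha 0 (by omega)) fun i hi h => by
          have h1 := ha (i + 1) (by omega)
          have h2 := hc (i + 1) (by omega)
          simp at h1 h2 h ⊢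
          omega
      omega
    · left
      have := add_max_le_sum_range
        (fun i => if i = 0 then p 0 0 + p 0 2 else g 1 (i - 1) + g 3 (i - 1)) (k + 1)
        (by simpa using hv2 hj) fun i hi h => by
          have h1 := ha i (by omega)
          have h2 := hc i (by omega)
          simp at h1 h2 h ⊢
          split_ifs at * <;> omega
      rw [Finset.sum_range_succ'] at this
      simp at this
      omega
  -- the vertices `a_i`, `c_i`, ending at `u_1`, `u_3`
  have hA : k + 2 ≤ ∑ i ∈ Finset.range (k + 1), (g 0 i + g 2 i) + (p 1 0 + p 1 2) := by
    have := add_max_le_sum_range_reverse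
      (fun i => if i = k + 1 then p 1 0 + p 1 2 else g 0 i + g 2 i) (k + 1)
      (by simpa using hu2) fun i hi h => by
        have h1 := hb i (by omega)
        have h2 := hd i (by omega)
        simp at h1 h2 h ⊢
        split_ifs at * <;> omega
    rw [Finset.sum_range_succ, Finset.sum_congr rfl (g := fun i => g 0 i + g 2 i)
      fun i hi => if_neg (by simp at hi; omega)] at this
    simp at this
    omega
  rcases hB with hB | ⟨rfl, hB⟩ <;> omega

lemma exists_almostTotalDominating {k : ℕ} (hk : 1 ≤ k) (j : Fin 3) :
    ∃ S : Finset (LkVert k), S.card = 2 * k + 3 ∧ Sum.inr (0, j) ∈ S ∧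
      (∀ u ∈ S, ¬ (LkGraph k).Adj (Sum.inr (0, j)) u) ∧
      ∀ w : LkVert k, w ≠ Sum.inr (0, j) → ∃ u ∈ S, (LkGraph k).Adj w u := by
  obtain ⟨c, hc⟩ : ∃ c : Fin 4, c = if j = 2 then 0 else 2 := ⟨_, rfl⟩
  have hc' : c = 0 ∧ j = 2 ∨ c = 2 ∧ j ≠ 2 := by grind
  have hc1 : c ≠ 1 := by rcases hc' with h | h <;> simp [h.1]
  refine ⟨(({1, c} : Finset (Fin 4)) ×ˢ Finset.univ).disjSum {(0, j), (1, 0), (1, 1)},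
    ?_, ?_, ?_, ?_⟩
  · rw [Finset.card_disjSum, Finset.card_product, Finset.card_pair hc1.symm,
      Finset.card_eq_three.2 ⟨(0, j), (1, 0), (1, 1), by simp⟩]
    simp
  · simp
  · rintro (⟨c', i⟩ | ⟨s, j'⟩) hu
    · simp [LkGraph, lkRel] at hu ⊢
      grind
    · simp [LkGraph, lkRel] at hu ⊢
      grind
  · rintro (⟨c', i⟩ | ⟨s, j'⟩) hw
    · fin_cases c'
      · exact ⟨.inl (1, i), by simp, by simp [LkGraph, lkRel, gkBase]⟩
      · exact ⟨.inl (c, i), by simp, by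
          rcases hc' with ⟨rfl, -⟩ | ⟨rfl, -⟩ <;> simp [LkGraph, lkRel, gkBase]⟩
      · exact ⟨.inl (1, i), by simp, by simp [LkGraph, lkRel, gkBase]⟩
      · exact ⟨.inl (c, i), by simp, by
          rcases hc' with ⟨rfl, -⟩ | ⟨rfl, -⟩ <;> simp [LkGraph, lkRel, gkBase]⟩
    · fin_cases s
      · by_cases hj : j = 1 ∨ j' = 1
        · exact ⟨.inr (0, j), by simp, by
            revert hw hj
            fin_cases j <;> fin_cases j' <;> simp [LkGraph, lkRel]⟩
        · exact ⟨.inl (c, ⟨0, hk⟩), by simp, by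
            subst hc
            revert hw hj
            fin_cases j <;> fin_cases j' <;> simp [LkGraph, lkRel]⟩
      · by_cases hj : j' = 1
        · exact ⟨.inr (1, 0), by simp, by simp [LkGraph, lkRel, hj]⟩
        · exact ⟨.inr (1, 1), by simp, by
            revert hj
            fin_cases j' <;> simp [LkGraph, lkRel]⟩

/-- For `k ≥ 1` and any vertex `w ∈ {v_1, v_2, v_3}` of the special 2-path
`a_1 v_1 v_2 v_3 c_1` of `L_k`, `γta(L_k; w) = n/2 = 2k + 3`. -/
theorem almostTotalDominationNumber_Lk (k : ℕ) (hk : 1 ≤ k) (j : Fin 3) :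
    almostTotalDominationNumber (LkGraph k) (Sum.inr ((0 : Fin 2), j)) = 2 * k + 3 := by
  refine (show IsLeast _ (2 * k + 3) from ⟨exists_almostTotalDominating hk j, ?_⟩).csInf_eq
  rintro _ ⟨S, rfl, hmem, hnot, hdom⟩
  exact le_card_of_almostTotalDominating hk j S hmem hnot hdom
end

section
/- For every integer k ≥ 1, γt(F_k) = γt(G_k) + 2. -/
open SimpleGraph

section TotalDomination

variable {V : Type*} [Fintype V] {G : SimpleGraph V}

theorem totalDominationNumber_le {S : Finset V} (hS : ∀ v, ∃ u ∈ S, G.Adj v u) :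
    totalDominationNumber G ≤ S.card :=
  Nat.sInf_le ⟨S, rfl, hS⟩

theorem exists_card_eq_totalDominationNumber {S : Finset V} (hS : ∀ v, ∃ u ∈ S, G.Adj v u) :
    ∃ T : Finset V, T.card = totalDominationNumber G ∧ ∀ v, ∃ u ∈ T, G.Adj v u :=
  Nat.sInf_mem (s := {n | ∃ T : Finset V, T.card = n ∧ ∀ v : V, ∃ u ∈ T, G.Adj v u})
    ⟨S.card, S, rfl, hS⟩

end TotalDomination

/-- The set of all vertices `b_i` and `c_i`. -/
def bcSet (k : ℕ) : Finset (Fin 4 × Fin k) := {1, 2} ×ˢ Finset.univ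

theorem card_bcSet (k : ℕ) : (bcSet k).card = 2 * k := by
  simp [bcSet, Finset.card_product]

theorem bcSet_dominates (k : ℕ) (v : Fin 4 × Fin k) : ∃ u ∈ bcSet k, (GkGraph k).Adj v u := by
  obtain ⟨x, i⟩ := v
  fin_cases x
  · exact ⟨(1, i), by simp [bcSet], by simp [GkGraph, gkRel, gkBase]⟩
  · exact ⟨(2, i), by simp [bcSet], by simp [GkGraph, gkRel, gkBase]⟩
  · exact ⟨(1, i), by simp [bcSet], by simp [GkGraph, gkRel, gkBase]⟩
  · exact ⟨(2, i), by simp [bcSet], by simp [GkGraph, gkRel, gkBase]⟩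

/-- Adding two of `v_1, v_2, v_3` to a total dominating set of `G_k` totally dominates `F_k`,
provided they dominate the path and make up for the missing edge `a_1 c_1`. -/
theorem disjSum_Fk_dominates {n : ℕ} {S : Finset (Fin 4 × Fin (n + 1))} {J : Finset (Fin 3)}
    (hS : ∀ v, ∃ u ∈ S, (GkGraph (n + 1)).Adj v u)
    (hJ : ∀ j, ∃ u ∈ S.disjSum J, (FkGraph (n + 1)).Adj (Sum.inr j) u)
    (ha : (2, 0) ∈ S → 0 ∈ J) (hc : (0, 0) ∈ S → 2 ∈ J) (v : FkVert (n + 1)) :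
    ∃ u ∈ S.disjSum J, (FkGraph (n + 1)).Adj v u := by
  obtain ⟨x, i⟩ | j := v
  · obtain ⟨⟨y, j⟩, hu, hxy⟩ := hS (x, i)
    have hadj : (FkGraph (n + 1)).Adj (Sum.inl (x, i)) (Sum.inl (y, j)) ∨
        (x = 0 ∧ y = 2 ∧ i = 0 ∧ j = 0) ∨ (x = 2 ∧ y = 0 ∧ i = 0 ∧ j = 0) := by
      simp only [GkGraph, fromRel_adj, gkRel] at hxy
      obtain ⟨hne, (h | h | h) | (h | h | h)⟩ := hxy
      · exact .inl ⟨by simpa using hne, .inl (.inl h)⟩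
      · exact .inr (.inl (by simpa using h))
      · exact .inl ⟨by simpa using hne, .inl (.inr h)⟩
      · exact .inl ⟨by simpa using hne, .inr (.inl h)⟩
      · exact .inr (.inr (by simp at h; tauto))
      · exact .inl ⟨by simpa using hne, .inr (.inr h)⟩
    obtain h | ⟨rfl, rfl, rfl, rfl⟩ | ⟨rfl, rfl, rfl, rfl⟩ := hadj
    · exact ⟨_, Finset.inl_mem_disjSum.2 hu, h⟩
    · exact ⟨Sum.inr 0, Finset.inr_mem_disjSum.2 (ha hu), by simp [FkGraph, fkRel]⟩
    · exact ⟨Sum.inr 2, Finset.inr_mem_disjSum.2 (hc hu), by simp [FkGraph, fkRel]⟩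
  · exact hJ j

/-- A total dominating set of `G_k` yields one of `F_k` with two more vertices. -/
theorem exists_Fk_dominating (n : ℕ) (S : Finset (Fin 4 × Fin (n + 1)))
    (hS : ∀ v, ∃ u ∈ S, (GkGraph (n + 1)).Adj v u) :
    ∃ T : Finset (FkVert (n + 1)), T.card = S.card + 2 ∧
      ∀ v, ∃ u ∈ T, (FkGraph (n + 1)).Adj v u := by
  by_cases ha : (0, 0) ∈ S
  · by_cases hc : (2, 0) ∈ S
    · refine ⟨S.disjSum {0, 2}, by simp [Finset.card_disjSum],
        disjSum_Fk_dominates hS (fun j => ?_) (by simp) (by simp)⟩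
      fin_cases j
      · exact ⟨Sum.inl (0, 0), by simp [ha], by simp [FkGraph, fkRel]⟩
      · exact ⟨Sum.inr 0, by simp, by simp [FkGraph, fkRel]⟩
      · exact ⟨Sum.inl (2, 0), by simp [hc], by simp [FkGraph, fkRel]⟩
    · refine ⟨S.disjSum {1, 2}, by simp [Finset.card_disjSum],
        disjSum_Fk_dominates hS (fun j => ?_) (absurd · hc) (by simp)⟩
      fin_cases j
      · exact ⟨Sum.inr 1, by simp, by simp [FkGraph, fkRel]⟩
      · exact ⟨Sum.inr 2, by simp, by simp [FkGraph, fkRel]⟩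
      · exact ⟨Sum.inr 1, by simp, by simp [FkGraph, fkRel]⟩
  · refine ⟨S.disjSum {0, 1}, by simp [Finset.card_disjSum],
      disjSum_Fk_dominates hS (fun j => ?_) (by simp) (absurd · ha)⟩
    fin_cases j
    · exact ⟨Sum.inr 1, by simp, by simp [FkGraph, fkRel]⟩
    · exact ⟨Sum.inr 0, by simp, by simp [FkGraph, fkRel]⟩
    · exact ⟨Sum.inr 1, by simp, by simp [FkGraph, fkRel]⟩

/-- If each zero of `u`, except possibly the first entry, is immediately preceded by a value at
least `2`, then the average of `u` is at least `1` up to boundary terms. -/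
theorem add_le_sum_of_two_le_before_zero (n : ℕ) (u : Fin (n + 1) → ℕ)
    (h : ∀ i : Fin n, u i.succ = 0 → 2 ≤ u i.castSucc) :
    n + 1 + (u (Fin.last n) - 1) ≤ ∑ i, u i + (1 - u 0) := by
  induction n with
  | zero => simp; omega
  | succ n ih =>
    have h1 := ih (fun i => u i.castSucc) fun i hi => h i.castSucc hi
    have h2 := h (Fin.last n)
    rw [Fin.sum_univ_castSucc]
    simp only [Fin.castSucc_zero, Fin.succ_last, Nat.succ_eq_add_one] at h1 h2 ⊢
    omega

theorem add_le_sum_of_two_le_after_zero (n : ℕ) (u : Fin (n + 1) → ℕ)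
    (h : ∀ i : Fin n, u i.castSucc = 0 → 2 ≤ u i.succ) :
    n + 1 + (u 0 - 1) ≤ ∑ i, u i + (1 - u (Fin.last n)) := by
  have := add_le_sum_of_two_le_before_zero n (fun i => u i.rev) fun i hi => by
    simpa [Fin.rev_castSucc] using h i.rev (by simpa [Fin.rev_succ] using hi)
  have hsum : ∑ i : Fin (n + 1), u i.rev = ∑ i, u i := Equiv.sum_comp Fin.revPerm u
  simpa only [hsum, Fin.rev_last, Fin.rev_zero] using this

/-- Every total dominating set of `F_k` has at least `2k + 2` elements. Its intersections with the
pairs `{b_i, d_i}` and `{a_i, c_i}` obey the two preceding estimates. -/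
theorem le_card_of_Fk_dominating (n : ℕ) (S : Finset (FkVert (n + 1)))
    (hS : ∀ v, ∃ u ∈ S, (FkGraph (n + 1)).Adj v u) : 2 * (n + 1) + 2 ≤ S.card := by
  classical
  let f : FkVert (n + 1) → ℕ := fun v => if v ∈ S then 1 else 0
  have hle : ∀ v, f v ≤ 1 := fun v => by simp only [f]; split_ifs <;> simp
  have hf : ∀ v, ∃ u, f u = 1 ∧ (FkGraph (n + 1)).Adj v u := fun v => by
    obtain ⟨u, hu, huv⟩ := hS v
    exact ⟨u, by simp [f, hu], huv⟩
  have hcard : S.card = ∑ v, f v := by simp [f]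
  clear_value f
  have eq_castSucc (i : Fin n) (j : Fin (n + 1)) (h : (j : ℕ) = i) : j = i.castSucc := Fin.ext h
  have eq_last (j : Fin (n + 1)) (h : (j : ℕ) = n) : j = Fin.last n := Fin.ext h
  have h_a_zero : 1 ≤ f (Sum.inl (1, 0)) + f (Sum.inl (3, 0)) + f (Sum.inr 0) := by
    obtain ⟨⟨y, j⟩ | j, hu, ha⟩ := hf (Sum.inl (0, 0))
    · fin_cases y <;> simp [FkGraph, fkRel, gkBase] at ha <;> grind
    · fin_cases j <;> simp [FkGraph, fkRel] at ha
      grind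
  have h_c_zero : 1 ≤ f (Sum.inl (1, 0)) + f (Sum.inl (3, 0)) + f (Sum.inr 2) := by
    obtain ⟨⟨y, j⟩ | j, hu, ha⟩ := hf (Sum.inl (2, 0))
    · fin_cases y <;> simp [FkGraph, fkRel, gkBase] at ha <;> grind
    · fin_cases j <;> simp [FkGraph, fkRel] at ha
      grind
  have h_a_succ (i : Fin n) :
      1 ≤ f (Sum.inl (1, i.succ)) + f (Sum.inl (3, i.succ)) + f (Sum.inl (1, i.castSucc)) := by
    obtain ⟨⟨y, j⟩ | j, hu, ha⟩ := hf (Sum.inl (0, i.succ))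
    · fin_cases y <;> simp [FkGraph, fkRel, gkBase] at ha <;> grind
    · fin_cases j <;> simp [FkGraph, fkRel] at ha
  have h_c_succ (i : Fin n) :
      1 ≤ f (Sum.inl (1, i.succ)) + f (Sum.inl (3, i.succ)) + f (Sum.inl (3, i.castSucc)) := by
    obtain ⟨⟨y, j⟩ | j, hu, ha⟩ := hf (Sum.inl (2, i.succ))
    · fin_cases y <;> simp [FkGraph, fkRel, gkBase] at ha <;> grind
    · fin_cases j <;> simp [FkGraph, fkRel] at ha
  have h_b_castSucc (i : Fin n) :
      1 ≤ f (Sum.inl (0, i.castSucc)) + f (Sum.inl (2, i.castSucc)) + f (Sum.inl (0, i.succ)) := by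
    obtain ⟨⟨y, j⟩ | j, hu, ha⟩ := hf (Sum.inl (1, i.castSucc))
    · fin_cases y <;> simp [FkGraph, fkRel, gkBase] at ha <;> grind
    · fin_cases j <;> simp [FkGraph, fkRel] at ha
  have h_d_castSucc (i : Fin n) :
      1 ≤ f (Sum.inl (0, i.castSucc)) + f (Sum.inl (2, i.castSucc)) + f (Sum.inl (2, i.succ)) := by
    obtain ⟨⟨y, j⟩ | j, hu, ha⟩ := hf (Sum.inl (3, i.castSucc))
    · fin_cases y <;> simp [FkGraph, fkRel, gkBase] at ha <;> grind
    · fin_cases j <;> simp [FkGraph, fkRel] at ha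
  have h_b_last :
      1 ≤ f (Sum.inl (0, Fin.last n)) + f (Sum.inl (2, Fin.last n)) + f (Sum.inl (3, Fin.last n)) := by
    obtain ⟨⟨y, j⟩ | j, hu, ha⟩ := hf (Sum.inl (1, Fin.last n))
    · fin_cases y <;> simp [FkGraph, fkRel, gkBase] at ha <;> grind
    · fin_cases j <;> simp [FkGraph, fkRel] at ha
  have h_d_last :
      1 ≤ f (Sum.inl (0, Fin.last n)) + f (Sum.inl (2, Fin.last n)) + f (Sum.inl (1, Fin.last n)) := by
    obtain ⟨⟨y, j⟩ | j, hu, ha⟩ := hf (Sum.inl (3, Fin.last n))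
    · fin_cases y <;> simp [FkGraph, fkRel, gkBase] at ha <;> grind
    · fin_cases j <;> simp [FkGraph, fkRel] at ha
  have h_v_one : 1 ≤ f (Sum.inl (0, 0)) + f (Sum.inr 1) := by
    obtain ⟨⟨y, j⟩ | j, hu, ha⟩ := hf (Sum.inr 0)
    · fin_cases y <;> simp [FkGraph, fkRel] at ha
      grind
    · fin_cases j <;> simp [FkGraph, fkRel] at ha
      grind
  have h_v_two : 1 ≤ f (Sum.inr 0) + f (Sum.inr 2) := by
    obtain ⟨⟨y, j⟩ | j, hu, ha⟩ := hf (Sum.inr 1)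
    · fin_cases y <;> simp [FkGraph, fkRel] at ha
    · fin_cases j <;> simp [FkGraph, fkRel] at ha <;> grind
  have h_v_three : 1 ≤ f (Sum.inl (2, 0)) + f (Sum.inr 1) := by
    obtain ⟨⟨y, j⟩ | j, hu, ha⟩ := hf (Sum.inr 2)
    · fin_cases y <;> simp [FkGraph, fkRel] at ha
      grind
    · fin_cases j <;> simp [FkGraph, fkRel] at ha
      grind
  have hbd := add_le_sum_of_two_le_before_zero n
    (fun i => f (Sum.inl (1, i)) + f (Sum.inl (3, i))) fun i hi => by
      have := h_a_succ i
      have := h_c_succ i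
      omega
  have hac := add_le_sum_of_two_le_after_zero n
    (fun i => f (Sum.inl (0, i)) + f (Sum.inl (2, i))) fun i hi => by
      have := h_b_castSucc i
      have := h_d_castSucc i
      omega
  simp only [Finset.sum_add_distrib] at hbd hac
  rw [hcard, Fintype.sum_sum_type, Fintype.sum_prod_type, Fin.sum_univ_four, Fin.sum_univ_three]
  have := hle (Sum.inl (0, 0))
  have := hle (Sum.inl (2, 0))
  have := hle (Sum.inl (1, Fin.last n))
  have := hle (Sum.inl (3, Fin.last n))
  omega

/-- For every `k ≥ 1`, `γt(F_k) = γt(G_k) + 2`. -/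
theorem totalDominationNumber_Fk_eq_Gk_add_two (k : ℕ) (hk : 1 ≤ k) :
    totalDominationNumber (FkGraph k) = totalDominationNumber (GkGraph k) + 2 := by
  obtain ⟨n, rfl⟩ : ∃ n, k = n + 1 := ⟨k - 1, by omega⟩
  obtain ⟨S, hScard, hS⟩ := exists_card_eq_totalDominationNumber (bcSet_dominates (n + 1))
  obtain ⟨U, hUcard, hU⟩ := exists_Fk_dominating n S hS
  obtain ⟨T, hTcard, hT⟩ := exists_card_eq_totalDominationNumber hU
  have hG := totalDominationNumber_le (bcSet_dominates (n + 1))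
  have hF := le_card_of_Fk_dominating n T hT
  have hFG := totalDominationNumber_le hU
  rw [card_bcSet] at hG
  omega
end

section
/- For every integer k ≥ 1, the cubic graph G_k of order 4k has total domination number γt(G_k) = 2k, i.e., its total domination number is exactly one-half its order. -/
open SimpleGraph

/-- Summation bound behind the lower bound: the pairs `(b i, d i)` followed by the pairs `(a i, c i)`
in reverse order form a closed chain in which each pair is nonzero or its predecessor is
nonzero in both entries. -/
theorem two_mul_le_sum_of_chain (a b c d : ℕ → ℕ) {k : ℕ} (hk : 1 ≤ k)
    (ha : ∀ i, i + 1 < k → 1 ≤ b i + b (i + 1) + d (i + 1))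
    (hc : ∀ i, i + 1 < k → 1 ≤ d i + d (i + 1) + b (i + 1))
    (hb : ∀ i, i + 1 < k → 1 ≤ a i + a (i + 1) + c i)
    (hd : ∀ i, i + 1 < k → 1 ≤ c i + c (i + 1) + a i)
    (ha₀ : 1 ≤ c 0 + b 0 + d 0) (hc₀ : 1 ≤ a 0 + d 0 + b 0)
    (hb₁ : 1 ≤ a (k - 1) + c (k - 1) + d (k - 1))
    (hd₁ : 1 ≤ c (k - 1) + a (k - 1) + b (k - 1)) :
    2 * k ≤ ∑ i ∈ Finset.range k, (a i + b i + c i + d i) := by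
  have key : ∀ m, m < k → 2 * m + 1 + min (b m) (d m) + max (a m) (c m) ≤
      ∑ i ∈ Finset.range (m + 1), (a i + b i + c i + d i) := by
    intro m
    induction m with
    | zero =>
      intro _
      rw [zero_add, Finset.sum_range_one]
      omega
    | succ m ih =>
      intro hm
      have := ih (by omega)
      have := ha m hm
      have := hb m hm
      have := hc m hm
      have := hd m hm
      rw [Finset.sum_range_succ]
      omega
  have := key (k - 1) (by omega)
  rw [Nat.sub_add_cancel hk] at this
  omega

/-- The possible neighbors of each of the four kinds of vertices of `G_k`. -/
theorem gkGraph_adj_cases {k : ℕ} {t s : Fin 4} {i j : Fin k} (h : (GkGraph k).Adj (t, i) (s, j)) :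
    (t = 0 → (s = 1 ∧ (j : ℕ) = i) ∨ (s = 1 ∧ (j : ℕ) + 1 = i) ∨ (s = 3 ∧ (j : ℕ) = i) ∨
      (s = 2 ∧ (i : ℕ) = 0 ∧ (j : ℕ) = 0)) ∧
    (t = 1 → (s = 0 ∧ (j : ℕ) = i) ∨ (s = 0 ∧ (j : ℕ) = i + 1) ∨ (s = 2 ∧ (j : ℕ) = i) ∨
      (s = 3 ∧ (i : ℕ) = k - 1 ∧ (j : ℕ) = k - 1)) ∧
    (t = 2 → (s = 3 ∧ (j : ℕ) = i) ∨ (s = 3 ∧ (j : ℕ) + 1 = i) ∨ (s = 1 ∧ (j : ℕ) = i) ∨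
      (s = 0 ∧ (i : ℕ) = 0 ∧ (j : ℕ) = 0)) ∧
    (t = 3 → (s = 2 ∧ (j : ℕ) = i) ∨ (s = 2 ∧ (j : ℕ) = i + 1) ∨ (s = 0 ∧ (j : ℕ) = i) ∨
      (s = 1 ∧ (i : ℕ) = k - 1 ∧ (j : ℕ) = k - 1)) := by
  simp only [GkGraph, SimpleGraph.fromRel_adj, gkRel, gkBase, Fin.ext_iff] at h ⊢
  have ht := t.isLt
  have hs := s.isLt
  simp only [Fin.isValue, Fin.val_zero, Fin.val_one, Fin.val_two,
    show ((3 : Fin 4) : ℕ) = 3 from rfl] at h ⊢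
  omega

theorem exists_total_dominating_gkGraph (k : ℕ) :
    ∃ S : Finset (Fin 4 × Fin k), S.card = 2 * k ∧ ∀ v, ∃ u ∈ S, (GkGraph k).Adj v u := by
  refine ⟨({0, 3} : Finset (Fin 4)) ×ˢ Finset.univ, by simp [Finset.card_product], ?_⟩
  rintro ⟨t, i⟩
  fin_cases t
  · exact ⟨(3, i), by simp, by simp [GkGraph, gkRel, gkBase]⟩
  · exact ⟨(0, i), by simp, by simp [GkGraph, gkRel, gkBase]⟩
  · exact ⟨(3, i), by simp, by simp [GkGraph, gkRel, gkBase]⟩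
  · exact ⟨(0, i), by simp, by simp [GkGraph, gkRel, gkBase]⟩

theorem two_mul_le_card_of_total_dominating_gkGraph {k : ℕ} (hk : 1 ≤ k)
    {S : Finset (Fin 4 × Fin k)} (hS : ∀ v, ∃ u ∈ S, (GkGraph k).Adj v u) :
    2 * k ≤ S.card := by
  classical
  let x : Fin 4 → ℕ → ℕ := fun t i => if ∃ h : i < k, (t, ⟨i, h⟩) ∈ S then 1 else 0
  have hx : ∀ t (j : Fin k), (t, j) ∈ S → 1 ≤ x t j := by
    intro t j h
    simp [x, h]
  have hcard : S.card = ∑ i ∈ Finset.range k, (x 0 i + x 1 i + x 2 i + x 3 i) := by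
    have : ∀ t (i : Fin k), (if (t, i) ∈ S then 1 else 0) = x t i := by simp [x]
    rw [← Fin.sum_univ_eq_sum_range (fun i => x 0 i + x 1 i + x 2 i + x 3 i),
      ← Finset.filter_univ_mem S, Finset.card_filter, Fintype.sum_prod_type_right]
    simp only [this, Fin.sum_univ_four]
  have dom : ∀ (t : Fin 4) (i : ℕ), i < k → ∃ s, ∃ j : ℕ, 1 ≤ x s j ∧
      ∃ (hi : i < k) (hj : j < k), (GkGraph k).Adj (t, ⟨i, hi⟩) (s, ⟨j, hj⟩) := by
    intro t i hi
    obtain ⟨⟨s, j⟩, hu, hadj⟩ := hS (t, ⟨i, hi⟩)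
    exact ⟨s, j, hx s j hu, hi, j.isLt, hadj⟩
  clear_value x
  rw [hcard]
  apply two_mul_le_sum_of_chain _ _ _ _ hk
  · intro i hi
    obtain ⟨s, j, h, _, _, hadj⟩ := dom 0 (i + 1) hi
    have := (gkGraph_adj_cases hadj).1 rfl
    grind
  · intro i hi
    obtain ⟨s, j, h, _, _, hadj⟩ := dom 2 (i + 1) hi
    have := (gkGraph_adj_cases hadj).2.2.1 rfl
    grind
  · intro i hi
    obtain ⟨s, j, h, _, _, hadj⟩ := dom 1 i (by omega)
    have := (gkGraph_adj_cases hadj).2.1 rfl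
    grind
  · intro i hi
    obtain ⟨s, j, h, _, _, hadj⟩ := dom 3 i (by omega)
    have := (gkGraph_adj_cases hadj).2.2.2 rfl
    grind
  · obtain ⟨s, j, h, _, _, hadj⟩ := dom 0 0 hk
    have := (gkGraph_adj_cases hadj).1 rfl
    grind
  · obtain ⟨s, j, h, _, _, hadj⟩ := dom 2 0 hk
    have := (gkGraph_adj_cases hadj).2.2.1 rfl
    grind
  · obtain ⟨s, j, h, _, _, hadj⟩ := dom 1 (k - 1) (by omega)
    have := (gkGraph_adj_cases hadj).2.1 rfl
    grind
  · obtain ⟨s, j, h, _, _, hadj⟩ := dom 3 (k - 1) (by omega)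
    have := (gkGraph_adj_cases hadj).2.2.2 rfl
    grind

/-- For every `k ≥ 1`, the cubic graph `G_k` of order `4k` has total domination number `2k`,
exactly one-half its order. -/
theorem totalDominationNumber_Gk (k : ℕ) (hk : 1 ≤ k) :
    totalDominationNumber (GkGraph k) = 2 * k := by
  apply le_antisymm
  · exact Nat.sInf_le (exists_total_dominating_gkGraph k)
  · refine le_csInf ⟨2 * k, exists_total_dominating_gkGraph k⟩ ?_
    rintro n ⟨S, rfl, hS⟩
    exact two_mul_le_card_of_total_dominating_gkGraph hk hS
end

section
/- Let k ≥ 2 and let v be any vertex of the graph H_k. Then γt(H_k − v) < γt(H_k). -/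
open SimpleGraph

/-- Cyclic succession of the blocks of `H_k`, in terms of the underlying natural numbers. -/
lemma Fin.val_add_one_cases {n : ℕ} (i : Fin (n + 2)) :
    ((i : ℕ) = n + 1 ∧ ((i + 1 : Fin (n + 2)) : ℕ) = 0) ∨
      ((i : ℕ) < n + 1 ∧ ((i + 1 : Fin (n + 2)) : ℕ) = i + 1) := by
  have h : ((i + 1 : Fin (n + 2)) : ℕ) = if i = Fin.last (n + 1) then 0 else (i : ℕ) + 1 :=
    Fin.val_add_one i
  have hi := i.isLt
  simp only [Fin.ext_iff, Fin.val_last] at h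
  split_ifs at h <;> omega

lemma HkGraph_adj_a {n : ℕ} (i : Fin (n + 2)) (q : Fin 4 × Fin (n + 2)) :
    (HkGraph (n + 2)).Adj (0, i + 1) q ↔ q = (1, i + 1) ∨ q = (3, i + 1) ∨ q = (1, i) := by
  obtain ⟨t, j⟩ := q
  have h := Fin.val_add_one_cases i
  generalize i + 1 = m at *
  fin_cases t <;> simp [HkGraph, hkRel, gkBase, -Fin.val_eq_zero_iff]
  all_goals
    simp only [Fin.ext_iff]
    omega

lemma HkGraph_adj_c {n : ℕ} (i : Fin (n + 2)) (q : Fin 4 × Fin (n + 2)) :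
    (HkGraph (n + 2)).Adj (2, i + 1) q ↔ q = (1, i + 1) ∨ q = (3, i + 1) ∨ q = (3, i) := by
  obtain ⟨t, j⟩ := q
  have h := Fin.val_add_one_cases i
  generalize i + 1 = m at *
  fin_cases t <;> simp [HkGraph, hkRel, gkBase, -Fin.val_eq_zero_iff]
  all_goals
    simp only [Fin.ext_iff]
    omega

lemma HkGraph_adj_b {n : ℕ} (i : Fin (n + 2)) (q : Fin 4 × Fin (n + 2)) :
    (HkGraph (n + 2)).Adj (1, i) q ↔ q = (0, i) ∨ q = (2, i) ∨ q = (0, i + 1) := by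
  obtain ⟨t, j⟩ := q
  have h := Fin.val_add_one_cases i
  generalize i + 1 = m at *
  fin_cases t <;> simp [HkGraph, hkRel, gkBase, -Fin.val_eq_zero_iff]
  all_goals
    simp only [Fin.ext_iff]
    omega

lemma HkGraph_adj_d {n : ℕ} (i : Fin (n + 2)) (q : Fin 4 × Fin (n + 2)) :
    (HkGraph (n + 2)).Adj (3, i) q ↔ q = (0, i) ∨ q = (2, i) ∨ q = (2, i + 1) := by
  obtain ⟨t, j⟩ := q
  have h := Fin.val_add_one_cases i
  generalize i + 1 = m at *
  fin_cases t <;> simp [HkGraph, hkRel, gkBase, -Fin.val_eq_zero_iff]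
  all_goals
    simp only [Fin.ext_iff]
    omega

/-- If an index with `f + g = 0` is always the image under `σ` of an index where both `f` and `g`
are positive, then the total weight of `f + g` is at least the number of indices. -/
lemma card_le_sum_of_perm {ι : Type*} [Fintype ι] (σ : Equiv.Perm ι) (f g : ι → ℕ)
    (hf : ∀ i, 1 ≤ f (σ i) + g (σ i) + f i) (hg : ∀ i, 1 ≤ f (σ i) + g (σ i) + g i) :
    Fintype.card ι ≤ ∑ i, (f i + g i) := by
  calc Fintype.card ι = ∑ _i : ι, 1 := by simp
    _ ≤ ∑ i, (min (f (σ i) + g (σ i)) 1 + (f i + g i - 1)) :=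
        Finset.sum_le_sum fun i _ => by have := hf i; have := hg i; omega
    _ = ∑ i, (min (f i + g i) 1 + (f i + g i - 1)) := by
        rw [Finset.sum_add_distrib, Equiv.sum_comp σ fun i => min (f i + g i) 1,
          ← Finset.sum_add_distrib]
    _ = ∑ i, (f i + g i) := Finset.sum_congr rfl fun i _ => by omega

lemma two_mul_le_card_of_HkGraph_dominated {n : ℕ} (S : Finset (Fin 4 × Fin (n + 2)))
    (hS : ∀ v, ∃ u ∈ S, (HkGraph (n + 2)).Adj v u) : 2 * (n + 2) ≤ S.card := by
  set x : Fin 4 → Fin (n + 2) → ℕ := fun t i => if (t, i) ∈ S then 1 else 0 with hx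
  have pos : ∀ {t i}, (t, i) ∈ S → x t i = 1 := fun h => if_pos h
  have hcard : S.card = ∑ i, (x 1 i + x 3 i) + ∑ i, (x 0 i + x 2 i) := by
    rw [← Finset.sum_add_distrib]
    calc S.card = ∑ p : Fin 4 × Fin (n + 2), x p.1 p.2 := by simp [hx]
      _ = _ := by
        rw [Fintype.sum_prod_type_right]
        refine Finset.sum_congr rfl fun i _ => ?_
        rw [Fin.sum_univ_four]
        dsimp only
        omega
  have hbd := card_le_sum_of_perm (Equiv.addRight (1 : Fin (n + 2))) (x 1) (x 3)
    (fun i => by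
      obtain ⟨u, hu, h⟩ := hS (0, i + 1)
      rw [HkGraph_adj_a] at h
      rw [Equiv.coe_addRight]
      rcases h with rfl | rfl | rfl <;> rw [pos hu] <;> omega)
    (fun i => by
      obtain ⟨u, hu, h⟩ := hS (2, i + 1)
      rw [HkGraph_adj_c] at h
      rw [Equiv.coe_addRight]
      rcases h with rfl | rfl | rfl <;> rw [pos hu] <;> omega)
  have hac := card_le_sum_of_perm (Equiv.addRight (1 : Fin (n + 2))).symm (x 0) (x 2)
    (fun i => by
      obtain ⟨j, rfl⟩ := (Equiv.addRight (1 : Fin (n + 2))).surjective i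
      obtain ⟨u, hu, h⟩ := hS (1, j)
      rw [HkGraph_adj_b] at h
      rw [Equiv.symm_apply_apply, Equiv.coe_addRight]
      rcases h with rfl | rfl | rfl <;> rw [pos hu] <;> omega)
    (fun i => by
      obtain ⟨j, rfl⟩ := (Equiv.addRight (1 : Fin (n + 2))).surjective i
      obtain ⟨u, hu, h⟩ := hS (3, j)
      rw [HkGraph_adj_d] at h
      rw [Equiv.symm_apply_apply, Equiv.coe_addRight]
      rcases h with rfl | rfl | rfl <;> rw [pos hu] <;> omega)
  rw [Fintype.card_fin] at hbd hac
  omega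

lemma two_mul_le_totalDominationNumber_HkGraph (n : ℕ) :
    2 * (n + 2) ≤ totalDominationNumber (HkGraph (n + 2)) := by
  refine le_csInf ⟨_, Finset.univ, rfl, fun ⟨t, i⟩ => ?_⟩ ?_
  · obtain ⟨j, rfl⟩ := (Equiv.addRight (1 : Fin (n + 2))).surjective i
    rw [Equiv.coe_addRight]
    fin_cases t
    · exact ⟨(1, j), Finset.mem_univ _, by simp [HkGraph_adj_a]⟩
    · exact ⟨(0, j + 1), Finset.mem_univ _, by simp [HkGraph_adj_b]⟩
    · exact ⟨(3, j), Finset.mem_univ _, by simp [HkGraph_adj_c]⟩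
    · exact ⟨(0, j + 1), Finset.mem_univ _, by simp [HkGraph_adj_d]⟩
  · rintro _ ⟨S, rfl, hS⟩
    exact two_mul_le_card_of_HkGraph_dominated S hS

/-- A set avoiding `v` and totally dominating every other vertex bounds the total domination
number of `G - v`. -/
lemma totalDominationNumber_deleteVert_le {V : Type*} [Fintype V] [DecidableEq V]
    (G : SimpleGraph V) (v : V) [Fintype {w : V // w ≠ v}] (S : Finset V) (hv : v ∉ S)
    (hS : ∀ w, w ≠ v → ∃ u ∈ S, G.Adj w u) :
    totalDominationNumber (deleteVert G v) ≤ S.card := by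
  have hdom : ∀ w : {w : V // w ≠ v}, ∃ u ∈ S.subtype (· ≠ v), (deleteVert G v).Adj w u := by
    rintro ⟨w, hw⟩
    obtain ⟨u, hu, h⟩ := hS w hw
    exact ⟨⟨u, ne_of_mem_of_not_mem hu hv⟩, Finset.mem_subtype.2 hu, h⟩
  have hle : totalDominationNumber (deleteVert G v) ≤ (S.subtype (· ≠ v)).card :=
    Nat.sInf_le ⟨_, rfl, hdom⟩
  refine hle.trans ?_
  rw [Finset.card_subtype]
  exact Finset.card_filter_le _ _

/-- All vertices of type `s` together with the vertices of type `t` outside block `j`. -/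
def fullAndPunctured {k : ℕ} (s t : Fin 4) (j : Fin k) : Finset (Fin 4 × Fin k) :=
  {s} ×ˢ Finset.univ ∪ {t} ×ˢ Finset.univ.erase j

lemma mem_fullAndPunctured {k : ℕ} {s t : Fin 4} {j : Fin k} {p : Fin 4 × Fin k} :
    p ∈ fullAndPunctured s t j ↔ p.1 = s ∨ p.1 = t ∧ p.2 ≠ j := by
  simp only [fullAndPunctured, Finset.mem_union, Finset.mem_product, Finset.mem_singleton,
    Finset.mem_univ, Finset.mem_erase, and_true]

lemma card_fullAndPunctured_lt {k : ℕ} (s t : Fin 4) (j : Fin k) :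
    (fullAndPunctured s t j).card < 2 * k := by
  have hj := j.isLt
  refine (Finset.card_union_le _ _).trans_lt ?_
  simp only [Finset.card_product, Finset.card_singleton, Finset.card_univ, Fintype.card_fin,
    Finset.card_erase_of_mem (Finset.mem_univ j)]
  omega

lemma exists_dominating_HkGraph_deleteVert {n : ℕ} (v : Fin 4 × Fin (n + 2)) :
    ∃ S : Finset (Fin 4 × Fin (n + 2)), S.card < 2 * (n + 2) ∧ v ∉ S ∧
      ∀ w, w ≠ v → ∃ u ∈ S, (HkGraph (n + 2)).Adj w u := by
  obtain ⟨t, j⟩ := v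
  refine ⟨fullAndPunctured (t + 2) t.rev j, card_fullAndPunctured_lt _ _ _, ?_, ?_⟩
  · rw [mem_fullAndPunctured]
    revert t
    simp only [ne_eq, not_true_eq_false, and_false, or_false]
    decide
  rintro ⟨s, i⟩ hw
  obtain ⟨i, rfl⟩ := (Equiv.addRight (1 : Fin (n + 2))).surjective i
  simp only [Equiv.coe_addRight] at hw ⊢
  have hne : i + 1 ≠ i := by simp
  have hne' : i + 1 + 1 ≠ i + 1 := by simp
  fin_cases t <;> fin_cases s <;>
    simp [HkGraph_adj_a, HkGraph_adj_b, HkGraph_adj_c, HkGraph_adj_d, mem_fullAndPunctured,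
      and_or_left, exists_or, -Prod.exists] at hw ⊢ <;> grind

/-- For `k ≥ 2` and any vertex `v` of `H_k`, `γt(H_k − v) < γt(H_k)`. -/
theorem Hk_deleteVert (k : ℕ) (hk : 2 ≤ k) (v : Fin 4 × Fin k) :
    totalDominationNumber (deleteVert (HkGraph k) v) <
      totalDominationNumber (HkGraph k) := by
  obtain ⟨n, rfl⟩ := Nat.exists_eq_add_of_le' hk
  obtain ⟨S, hcard, hv, hS⟩ := exists_dominating_HkGraph_deleteVert v
  exact (totalDominationNumber_deleteVert_le _ v S hv hS).trans_lt
    (hcard.trans_le (two_mul_le_totalDominationNumber_HkGraph n))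
end

section
/- For every vertex v of the generalized Petersen graph GP_16 = GP(8,3), γt(GP_16 − v) < γt(GP_16). -/
open SimpleGraph

instance : DecidableRel gpRel := fun _ _ => by unfold gpRel; infer_instance

instance : DecidableRel GP16.Adj := fun p q =>
  inferInstanceAs (Decidable (p ≠ q ∧ (gpRel p q ∨ gpRel q p)))

/-- The vertex of index `i` in the bipartition class `e` of `GP16`. -/
def gpClassVertex (e : Fin 2) (i : Fin 8) : Fin 2 × Fin 8 :=
  (e + Fin.ofNat 2 i, i)

/-- The bipartition class of a vertex of `GP16`. -/
def gpClass (p : Fin 2 × Fin 8) : Fin 2 := p.1 + Fin.ofNat 2 p.2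

theorem gpClassVertex_gpClass (p : Fin 2 × Fin 8) : gpClassVertex (gpClass p) p.2 = p := by
  revert p; decide

theorem gpClass_of_adj (e : Fin 2) (i : Fin 8) (q : Fin 2 × Fin 8)
    (h : GP16.Adj (gpClassVertex (e + 1) i) q) : gpClass q = e := by
  revert e i q; decide

theorem exists_not_adj_three : ∀ (e : Fin 2) (a b c : Fin 8), ∃ i : Fin 8,
    ¬ GP16.Adj (gpClassVertex (e + 1) i) (gpClassVertex e a) ∧
    ¬ GP16.Adj (gpClassVertex (e + 1) i) (gpClassVertex e b) ∧
    ¬ GP16.Adj (gpClassVertex (e + 1) i) (gpClassVertex e c) := by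
  decide +kernel

theorem Finset.exists_subset_triple {α : Type*} [DecidableEq α] [Inhabited α] {T : Finset α}
    (h : T.card ≤ 3) : ∃ a b c, T ⊆ {a, b, c} := by
  obtain h | h | h | h : T.card = 0 ∨ T.card = 1 ∨ T.card = 2 ∨ T.card = 3 := by omega
  · exact ⟨default, default, default, by simp [Finset.card_eq_zero.1 h]⟩
  · obtain ⟨a, rfl⟩ := Finset.card_eq_one.1 h
    exact ⟨a, a, a, by simp⟩
  · obtain ⟨a, b, -, rfl⟩ := Finset.card_eq_two.1 h
    exact ⟨a, b, b, by simp⟩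
  · obtain ⟨a, b, c, -, -, -, rfl⟩ := Finset.card_eq_three.1 h
    exact ⟨a, b, c, subset_rfl⟩

theorem four_le_card_filter_gpClass {S : Finset (Fin 2 × Fin 8)}
    (hS : ∀ v, ∃ u ∈ S, GP16.Adj v u) (e : Fin 2) :
    4 ≤ (S.filter (gpClass · = e)).card := by
  by_contra! h
  obtain ⟨a, b, c, habc⟩ := Finset.exists_subset_triple
    (Finset.card_image_le.trans (Nat.le_of_lt_succ h) :
      ((S.filter (gpClass · = e)).image Prod.snd).card ≤ 3)
  obtain ⟨i, ha, hb, hc⟩ := exists_not_adj_three e a b c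
  obtain ⟨u, hu, hadj⟩ := hS (gpClassVertex (e + 1) i)
  have he : gpClass u = e := gpClass_of_adj e i u hadj
  have hmem := habc (Finset.mem_image_of_mem Prod.snd (Finset.mem_filter.2 ⟨hu, he⟩))
  rw [← gpClassVertex_gpClass u, he] at hadj
  simp only [Finset.mem_insert, Finset.mem_singleton] at hmem
  obtain h | h | h := hmem <;> rw [h] at hadj <;> contradiction

theorem eight_le_card_of_totalDominating_GP16 {S : Finset (Fin 2 × Fin 8)}
    (hS : ∀ v, ∃ u ∈ S, GP16.Adj v u) : 8 ≤ S.card := by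
  have h0 := four_le_card_filter_gpClass hS 0
  have h1 := four_le_card_filter_gpClass hS 1
  have hne : S.filter (¬ gpClass · = 0) = S.filter (gpClass · = 1) :=
    Finset.filter_congr fun p _ => by omega
  have := Finset.card_filter_add_card_filter_not (s := S) (gpClass · = 0)
  rw [hne] at this
  omega

/-- A total dominating set of `GP16 - v`, obtained from one for `v = u_0` by an automorphism
of `GP16`. -/
def gpDeleteDominatingSet (v : Fin 2 × Fin 8) : Finset (Fin 2 × Fin 8) :=
  ({(1, 4), (0, 3), (0, 5), (0, 2), (0, 6), (1, 5), (1, 7)} : Finset (Fin 2 × Fin 8)).image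
    fun p => (p.1 + v.1, (if v.1 = 0 then p.2 else 3 * p.2) + v.2)

theorem gpDeleteDominatingSet_spec : ∀ v : Fin 2 × Fin 8,
    (gpDeleteDominatingSet v).card = 7 ∧ v ∉ gpDeleteDominatingSet v ∧
    ∀ w, w ≠ v → ∃ u ∈ gpDeleteDominatingSet v, GP16.Adj w u := by
  decide +kernel

theorem totalDominationNumber_deleteVert_GP16_le (v : Fin 2 × Fin 8) :
    totalDominationNumber (deleteVert GP16 v) ≤ 7 := by
  obtain ⟨hcard, hv, hdom⟩ := gpDeleteDominatingSet_spec v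
  refine Nat.sInf_le ⟨(gpDeleteDominatingSet v).subtype (· ≠ v), ?_, fun w => ?_⟩
  · rw [Finset.card_subtype, Finset.filter_true_of_mem, hcard]
    rintro u hu rfl
    exact hv hu
  · obtain ⟨u, hu, hadj⟩ := hdom w w.2
    exact ⟨⟨u, fun h => hv (h ▸ hu)⟩, Finset.mem_subtype.2 hu, hadj⟩

theorem eight_le_totalDominationNumber_GP16 : 8 ≤ totalDominationNumber GP16 := by
  refine le_csInf ⟨_, Finset.univ, rfl, by decide⟩ ?_
  rintro _ ⟨S, rfl, hS⟩
  exact eight_le_card_of_totalDominating_GP16 hS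

/-- For every vertex `v` of the generalized Petersen graph `GP(8,3)`,
`γt(GP_16 − v) < γt(GP_16)`. -/
theorem GP16_deleteVert (v : Fin 2 × Fin 8) :
    totalDominationNumber (deleteVert GP16 v) < totalDominationNumber GP16 :=
  (totalDominationNumber_deleteVert_GP16_le v).trans_lt eight_le_totalDominationNumber_GP16
end

section
/- Let k ≥ 1 and let v be a vertex of the graph F_k. If v ∈ {b_k, d_k}, then γta(F_k; v) < γt(F_k); otherwise γt(F_k − v) < γt(F_k). -/
open SimpleGraph

namespace FkGraph

variable {k : ℕ}

/-- The vertex `a_{i+1}` (`s = false`) or `c_{i+1}` (`s = true`). -/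
def hub (s : Bool) (i : Fin k) : FkVert k := Sum.inl (if s then 2 else 0, i)

/-- The vertex `b_{i+1}` (`s = false`) or `d_{i+1}` (`s = true`). -/
def rim (s : Bool) (i : Fin k) : FkVert k := Sum.inl (if s then 3 else 1, i)

/-- The vertex `v_1` (`s = false`) or `v_3` (`s = true`). -/
def fork (s : Bool) : FkVert k := Sum.inr (if s then 2 else 0)

/-- The vertex `v_2`. -/
def mid : FkVert k := Sum.inr 1

theorem vertex_cases (v : FkVert k) :
    (∃ s i, v = hub s i) ∨ (∃ s i, v = rim s i) ∨ (∃ s, v = fork s) ∨ v = mid := by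
  rcases v with ⟨p, i⟩ | j
  · fin_cases p
    · exact .inl ⟨false, i, rfl⟩
    · exact .inr (.inl ⟨false, i, rfl⟩)
    · exact .inl ⟨true, i, rfl⟩
    · exact .inr (.inl ⟨true, i, rfl⟩)
  · fin_cases j
    · exact .inr (.inr (.inl ⟨false, rfl⟩))
    · exact .inr (.inr (.inr rfl))
    · exact .inr (.inr (.inl ⟨true, rfl⟩))

@[simp] theorem hub_inj {s t : Bool} {i j : Fin k} : hub s i = hub t j ↔ s = t ∧ i = j := by
  cases s <;> cases t <;> simp [hub]

@[simp] theorem rim_inj {s t : Bool} {i j : Fin k} : rim s i = rim t j ↔ s = t ∧ i = j := by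
  cases s <;> cases t <;> simp [rim]

@[simp] theorem fork_inj {s t : Bool} : (fork s : FkVert k) = fork t ↔ s = t := by
  cases s <;> cases t <;> simp [fork]

@[simp] theorem hub_ne_rim {s t : Bool} {i j : Fin k} : hub s i ≠ rim t j := by
  cases s <;> cases t <;> simp [hub, rim]

@[simp] theorem rim_ne_hub {s t : Bool} {i j : Fin k} : rim s i ≠ hub t j := hub_ne_rim.symm

@[simp] theorem hub_ne_fork {s t : Bool} {i : Fin k} : hub s i ≠ fork t := Sum.inl_ne_inr

@[simp] theorem fork_ne_hub {s t : Bool} {i : Fin k} : fork t ≠ hub s i := Sum.inr_ne_inl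

@[simp] theorem rim_ne_fork {s t : Bool} {i : Fin k} : rim s i ≠ fork t := Sum.inl_ne_inr

@[simp] theorem fork_ne_rim {s t : Bool} {i : Fin k} : fork t ≠ rim s i := Sum.inr_ne_inl

@[simp] theorem hub_ne_mid {s : Bool} {i : Fin k} : hub s i ≠ mid := Sum.inl_ne_inr

@[simp] theorem mid_ne_hub {s : Bool} {i : Fin k} : mid ≠ hub s i := Sum.inr_ne_inl

@[simp] theorem rim_ne_mid {s : Bool} {i : Fin k} : rim s i ≠ mid := Sum.inl_ne_inr

@[simp] theorem mid_ne_rim {s : Bool} {i : Fin k} : mid ≠ rim s i := Sum.inr_ne_inl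

@[simp] theorem fork_ne_mid {s : Bool} : (fork s : FkVert k) ≠ mid := by
  cases s <;> simp [fork, mid]

@[simp] theorem mid_ne_fork {s : Bool} : (mid : FkVert k) ≠ fork s := fork_ne_mid.symm

@[simp] theorem adj_hub_hub {s t : Bool} {i j : Fin k} :
    ¬ (FkGraph k).Adj (hub s i) (hub t j) := by
  cases s <;> cases t <;> simp [FkGraph, fkRel, gkBase, hub]

@[simp] theorem adj_hub_rim {s t : Bool} {i j : Fin k} :
    (FkGraph k).Adj (hub s i) (rim t j) ↔ i = j ∨ s = t ∧ (j : ℕ) + 1 = i := by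
  cases s <;> cases t <;> simp [FkGraph, fkRel, gkBase, hub, rim, eq_comm]

@[simp] theorem adj_rim_hub {s t : Bool} {i j : Fin k} :
    (FkGraph k).Adj (rim t j) (hub s i) ↔ i = j ∨ s = t ∧ (j : ℕ) + 1 = i := by
  rw [SimpleGraph.adj_comm, adj_hub_rim]

@[simp] theorem adj_rim_rim {s t : Bool} {i j : Fin k} :
    (FkGraph k).Adj (rim s i) (rim t j) ↔ s ≠ t ∧ (i : ℕ) = k - 1 ∧ (j : ℕ) = k - 1 := by
  cases s <;> cases t <;> simp [FkGraph, fkRel, gkBase, rim, and_comm]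

@[simp] theorem adj_hub_fork {s t : Bool} {i : Fin k} :
    (FkGraph k).Adj (hub s i) (fork t) ↔ s = t ∧ (i : ℕ) = 0 := by
  cases s <;> cases t <;> simp [FkGraph, fkRel, hub, fork]

@[simp] theorem adj_fork_hub {s t : Bool} {i : Fin k} :
    (FkGraph k).Adj (fork t) (hub s i) ↔ s = t ∧ (i : ℕ) = 0 := by
  rw [SimpleGraph.adj_comm, adj_hub_fork]

@[simp] theorem adj_rim_fork {s t : Bool} {i : Fin k} :
    ¬ (FkGraph k).Adj (rim s i) (fork t) := by
  cases s <;> cases t <;> simp [FkGraph, fkRel, rim, fork]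

@[simp] theorem adj_fork_rim {s t : Bool} {i : Fin k} :
    ¬ (FkGraph k).Adj (fork t) (rim s i) := by
  rw [SimpleGraph.adj_comm]; exact adj_rim_fork

@[simp] theorem adj_hub_mid {s : Bool} {i : Fin k} : ¬ (FkGraph k).Adj (hub s i) mid := by
  cases s <;> simp [FkGraph, fkRel, hub, mid]

@[simp] theorem adj_mid_hub {s : Bool} {i : Fin k} : ¬ (FkGraph k).Adj mid (hub s i) := by
  rw [SimpleGraph.adj_comm]; exact adj_hub_mid

@[simp] theorem adj_rim_mid {s : Bool} {i : Fin k} : ¬ (FkGraph k).Adj (rim s i) mid := by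
  cases s <;> simp [FkGraph, fkRel, rim, mid]

@[simp] theorem adj_mid_rim {s : Bool} {i : Fin k} : ¬ (FkGraph k).Adj mid (rim s i) := by
  rw [SimpleGraph.adj_comm]; exact adj_rim_mid

@[simp] theorem adj_fork_fork {s t : Bool} : ¬ (FkGraph k).Adj (fork s) (fork t) := by
  cases s <;> cases t <;> simp [FkGraph, fkRel, fork]

@[simp] theorem adj_fork_mid {s : Bool} : (FkGraph k).Adj (fork s) mid := by
  cases s <;> simp [FkGraph, fkRel, fork, mid]

@[simp] theorem adj_mid_fork {s : Bool} : (FkGraph k).Adj mid (fork s) := adj_fork_mid.symm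

/-- The position of a vertex in the chain
`{v_1, v_3}, {b_1, d_1}, …, {b_k, d_k}, {a_k, c_k}, …, {a_1, c_1}, {v_2}`. -/
def level : FkVert k → ℕ
  | Sum.inl (p, i) => if p = 0 ∨ p = 2 then 2 * k - i else i + 1
  | Sum.inr j => if j = 1 then 2 * k + 1 else 0

@[simp] theorem level_hub (s : Bool) (i : Fin k) : level (hub s i) = 2 * k - i := by
  cases s <;> simp [hub, level]

@[simp] theorem level_rim (s : Bool) (i : Fin k) : level (rim s i) = i + 1 := by
  cases s <;> simp [rim, level]

@[simp] theorem level_fork (s : Bool) : level (fork s : FkVert k) = 0 := by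
  cases s <;> simp [fork, level]

@[simp] theorem level_mid : level (mid : FkVert k) = 2 * k + 1 := by
  simp [mid, level]

theorem level_lt (v : FkVert k) : level v < 2 * k + 2 := by
  obtain ⟨s, i, rfl⟩ | ⟨s, i, rfl⟩ | ⟨s, rfl⟩ | rfl := vertex_cases v <;> simp <;> omega

theorem adj_mid_imp {u : FkVert k} (h : (FkGraph k).Adj mid u) : level u = 0 := by
  obtain ⟨s, i, rfl⟩ | ⟨s, i, rfl⟩ | ⟨s, rfl⟩ | rfl := vertex_cases u <;> simp at h ⊢

/-- Each two consecutive levels `j`, `j + 1` contain the neighborhoods of two vertices whose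
common neighbors all lie in level `j + 1`. -/
theorem exists_link {j : ℕ} (hj : j ≤ 2 * k) : ∃ d : Bool → FkVert k,
    (∀ s u, (FkGraph k).Adj (d s) u → level u = j ∨ level u = j + 1) ∧
    ∀ u, (∀ s, (FkGraph k).Adj (d s) u) → level u = j + 1 := by
  rcases lt_or_ge j k with h | h
  · refine ⟨fun s => hub s ⟨j, h⟩, fun s u hu => ?_, fun u hu => ?_⟩
    · obtain ⟨t, i, rfl⟩ | ⟨t, i, rfl⟩ | ⟨t, rfl⟩ | rfl := vertex_cases u <;>
        simp [Fin.ext_iff] at hu ⊢ <;> omega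
    · obtain ⟨t, i, rfl⟩ | ⟨t, i, rfl⟩ | ⟨t, rfl⟩ | rfl := vertex_cases u <;>
        simp [Fin.ext_iff] at hu ⊢ <;> cases t <;> simp at hu <;> omega
  rcases hj.lt_or_eq with h' | rfl
  · refine ⟨fun s => rim s ⟨2 * k - 1 - j, by omega⟩, fun s u hu => ?_, fun u hu => ?_⟩
    · obtain ⟨t, i, rfl⟩ | ⟨t, i, rfl⟩ | ⟨t, rfl⟩ | rfl := vertex_cases u <;>
        simp [Fin.ext_iff] at hu ⊢ <;> omega
    · obtain ⟨t, i, rfl⟩ | ⟨t, i, rfl⟩ | ⟨t, rfl⟩ | rfl := vertex_cases u <;>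
        simp [Fin.ext_iff] at hu ⊢ <;> cases t <;> simp at hu <;> omega
  · refine ⟨fun s => fork s, fun s u hu => ?_, fun u hu => ?_⟩
    · obtain ⟨t, i, rfl⟩ | ⟨t, i, rfl⟩ | ⟨t, rfl⟩ | rfl := vertex_cases u <;>
        simp at hu ⊢
      omega
    · obtain ⟨t, i, rfl⟩ | ⟨t, i, rfl⟩ | ⟨t, rfl⟩ | rfl := vertex_cases u <;>
        simp at hu ⊢
      cases t <;> simp at hu

theorem le_sum_of_chain {w : ℕ → ℕ} (h0 : 1 ≤ w 0) (n : ℕ)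
    (h : ∀ j < n, 1 ≤ w (j + 1) ∨ 2 ≤ w j) :
    n + max 1 (w n) ≤ ∑ j ∈ Finset.range (n + 1), w j := by
  induction n with
  | zero => simpa using h0
  | succ n ih =>
    have := ih fun j hj => h j (by omega)
    have := h n (by omega)
    rw [Finset.sum_range_succ]
    omega

theorem le_card_of_total {S : Finset (FkVert k)} (hS : ∀ v, ∃ u ∈ S, (FkGraph k).Adj v u) :
    2 * k + 2 ≤ S.card := by
  classical
  have hcard : S.card = ∑ j ∈ Finset.range (2 * k + 1 + 1), (S.filter (level · = j)).card :=
    Finset.card_eq_sum_card_fiberwise fun v _ => by simpa using Nat.lt_succ_iff.1 (level_lt v)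
  have hpos : ∀ {u : FkVert k} {j : ℕ}, u ∈ S → level u = j →
      1 ≤ (S.filter (level · = j)).card := fun hu hj =>
    Finset.card_pos.2 ⟨_, Finset.mem_filter.2 ⟨hu, hj⟩⟩
  have hsum := le_sum_of_chain (w := fun j => (S.filter (level · = j)).card)
    (by obtain ⟨u, hu, h⟩ := hS mid; exact hpos hu (adj_mid_imp h)) (2 * k + 1) (by
      intro j hj
      obtain ⟨d, hd, hd'⟩ := exists_link (show j ≤ 2 * k by omega)
      choose p hp hadj using fun s => hS (d s)
      by_cases hlev : ∃ s, level (p s) = j + 1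
      · obtain ⟨s, hs⟩ := hlev
        exact .inl (hpos (hp s) hs)
      · push Not at hlev
        have hj : ∀ s, level (p s) = j := fun s => (hd s _ (hadj s)).resolve_right (hlev s)
        refine .inr (Finset.one_lt_card.2 ⟨p false, by simp [hp, hj], p true, by simp [hp, hj],
          fun he => hlev true (hd' _ ?_)⟩)
        rintro (_ | _)
        · exact he ▸ hadj false
        · exact hadj true)
  omega

theorem exists_total (k : ℕ) :
    ∃ S : Finset (FkVert k), ∀ v, ∃ u ∈ S, (FkGraph k).Adj v u := by
  refine ⟨Finset.univ, fun v => ?_⟩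
  obtain ⟨s, i, rfl⟩ | ⟨s, i, rfl⟩ | ⟨s, rfl⟩ | rfl := vertex_cases v
  · exact ⟨rim s i, by simp⟩
  · exact ⟨hub s i, by simp⟩
  · exact ⟨mid, by simp⟩
  · exact ⟨fork true, by simp⟩

theorem le_totalDominationNumber (k : ℕ) : 2 * k + 2 ≤ totalDominationNumber (FkGraph k) := by
  obtain ⟨S, hS⟩ := exists_total k
  refine le_csInf ⟨_, S, rfl, hS⟩ ?_
  rintro _ ⟨S, rfl, hS⟩
  exact le_card_of_total hS

theorem totalDominationNumber_deleteVert_le {V : Type*} [Fintype V] {G : SimpleGraph V} {v : V}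
    [Fintype {w : V // w ≠ v}] {S : Finset V} (hv : v ∉ S)
    (hS : ∀ w ≠ v, ∃ u ∈ S, G.Adj w u) : totalDominationNumber (deleteVert G v) ≤ S.card := by
  classical
  refine Nat.sInf_le ⟨S.subtype (· ≠ v), ?_, ?_⟩
  · rw [Finset.card_subtype, Finset.filter_true_of_mem]
    rintro u hu rfl
    exact hv hu
  · rintro ⟨w, hw⟩
    obtain ⟨u, hu, h⟩ := hS w hw
    exact ⟨⟨u, fun he => hv (he ▸ hu)⟩, by simpa using hu, h⟩

/-- The vertices on side `s` of the form `a`, `c` with index in `I` and `b`, `d` with index in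
`J`, together with the vertices in `E`. -/
def sideSet (s : Bool) (I J : Finset (Fin k)) (E : Finset (FkVert k)) : Finset (FkVert k) :=
  I.image (hub s) ∪ J.image (rim s) ∪ E

theorem card_sideSet_le (s : Bool) (I J : Finset (Fin k)) (E : Finset (FkVert k)) :
    (sideSet s I J E).card ≤ I.card + J.card + E.card :=
  (Finset.card_union_le _ _).trans <| Nat.add_le_add_right
    ((Finset.card_union_le _ _).trans
      (Nat.add_le_add Finset.card_image_le Finset.card_image_le)) _

theorem card_sideSet_pair_le {s : Bool} {I J : Finset (Fin k)} {x y : FkVert k}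
    (h : I.card + J.card < 2 * k) : (sideSet s I J {x, y}).card ≤ 2 * k + 1 := by
  have := card_sideSet_le s I J {x, y}
  have : ({x, y} : Finset (FkVert k)).card ≤ 2 := Finset.card_le_two
  omega

theorem card_sideSet_singleton_le {s : Bool} {x : FkVert k} :
    (sideSet s .univ .univ {x}).card ≤ 2 * k + 1 := by
  have := card_sideSet_le s .univ .univ {x}
  simp at this
  omega

theorem card_erase_lt (i : Fin k) : (Finset.univ.erase i).card < k := by
  simpa using Finset.card_erase_lt_of_mem (Finset.mem_univ i)

@[simp] theorem hub_mem_sideSet {s t : Bool} {I J : Finset (Fin k)} {E : Finset (FkVert k)}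
    {i : Fin k} : hub t i ∈ sideSet s I J E ↔ s = t ∧ i ∈ I ∨ hub t i ∈ E := by
  simp [sideSet]
  tauto

@[simp] theorem rim_mem_sideSet {s t : Bool} {I J : Finset (Fin k)} {E : Finset (FkVert k)}
    {i : Fin k} : rim t i ∈ sideSet s I J E ↔ s = t ∧ i ∈ J ∨ rim t i ∈ E := by
  simp [sideSet]
  tauto

@[simp] theorem fork_mem_sideSet {s t : Bool} {I J : Finset (Fin k)} {E : Finset (FkVert k)} :
    fork t ∈ sideSet s I J E ↔ fork t ∈ E := by
  simp [sideSet]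

@[simp] theorem mid_mem_sideSet {s : Bool} {I J : Finset (Fin k)} {E : Finset (FkVert k)} :
    mid ∈ sideSet s I J E ↔ mid ∈ E := by
  simp [sideSet]

theorem deleteVert_hub_le (s : Bool) (i : Fin k) :
    totalDominationNumber (deleteVert (FkGraph k) (hub s i)) ≤ 2 * k + 1 := by
  refine (totalDominationNumber_deleteVert_le
    (S := sideSet (!s) .univ (.erase .univ i) {fork (!s), mid}) (by simp) fun w hw => ?_).trans
    (card_sideSet_pair_le (by have := card_erase_lt i; simp at this ⊢; omega))
  obtain ⟨t, j, rfl⟩ | ⟨t, j, rfl⟩ | ⟨t, rfl⟩ | rfl := vertex_cases w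
  · by_cases hj : j = i
    · subst hj
      have ht : t = !s := by cases s <;> cases t <;> simp at hw ⊢
      by_cases h0 : (j : ℕ) = 0
      · exact ⟨fork t, by simp [ht, h0]⟩
      · exact ⟨rim t ⟨j - 1, by omega⟩, by simp [ht, Fin.ext_iff]; omega⟩
    · exact ⟨rim (!s) j, by simp [hj]⟩
  · exact ⟨hub (!s) j, by simp⟩
  · exact ⟨mid, by simp⟩
  · exact ⟨fork (!s), by simp⟩

theorem deleteVert_rim_le (s : Bool) {i : Fin k} (hi : (i : ℕ) ≠ k - 1) :
    totalDominationNumber (deleteVert (FkGraph k) (rim s i)) ≤ 2 * k + 1 := by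
  refine (totalDominationNumber_deleteVert_le
    (S := sideSet (!s) (.erase .univ i) .univ {fork (!s), mid}) (by simp) fun w hw => ?_).trans
    (card_sideSet_pair_le (by have := card_erase_lt i; simp at this ⊢; omega))
  obtain ⟨t, j, rfl⟩ | ⟨t, j, rfl⟩ | ⟨t, rfl⟩ | rfl := vertex_cases w
  · exact ⟨rim (!s) j, by simp⟩
  · by_cases hj : j = i
    · subst hj
      have ht : t = !s := by cases s <;> cases t <;> simp at hw ⊢
      exact ⟨hub t ⟨j + 1, by omega⟩, by simp [ht, Fin.ext_iff]⟩
    · exact ⟨hub (!s) j, by simp [hj]⟩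
  · exact ⟨mid, by simp⟩
  · exact ⟨fork (!s), by simp⟩

theorem deleteVert_fork_le (hk : 1 ≤ k) (s : Bool) :
    totalDominationNumber (deleteVert (FkGraph k) (fork s)) ≤ 2 * k + 1 := by
  refine (totalDominationNumber_deleteVert_le
    (S := sideSet (!s) .univ .univ {fork (!s)}) (by simp) fun w hw => ?_).trans
    card_sideSet_singleton_le
  obtain ⟨t, j, rfl⟩ | ⟨t, j, rfl⟩ | ⟨t, rfl⟩ | rfl := vertex_cases w
  · exact ⟨rim (!s) j, by simp⟩
  · exact ⟨hub (!s) j, by simp⟩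
  · have ht : t = !s := by cases s <;> cases t <;> simp at hw ⊢
    exact ⟨hub t ⟨0, hk⟩, by simp [ht]⟩
  · exact ⟨fork (!s), by simp⟩

theorem deleteVert_mid_le (hk : 1 ≤ k) :
    totalDominationNumber (deleteVert (FkGraph k) mid) ≤ 2 * k + 1 := by
  refine (totalDominationNumber_deleteVert_le
    (S := sideSet true .univ .univ {hub false ⟨0, hk⟩}) (by simp) fun w hw => ?_).trans
    card_sideSet_singleton_le
  obtain ⟨t, j, rfl⟩ | ⟨t, j, rfl⟩ | ⟨t, rfl⟩ | rfl := vertex_cases w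
  · exact ⟨rim true j, by simp⟩
  · exact ⟨hub true j, by simp⟩
  · exact ⟨hub t ⟨0, hk⟩, by cases t <;> simp⟩
  · exact absurd rfl hw

theorem almostTotalDominationNumber_rim_le (s : Bool) {i : Fin k} (hi : (i : ℕ) = k - 1) :
    almostTotalDominationNumber (FkGraph k) (rim s i) ≤ 2 * k + 1 := by
  refine le_trans ?_ (card_sideSet_pair_le (s := s) (I := .erase .univ i) (J := .univ)
    (x := fork s) (y := mid) (by have := card_erase_lt i; simp at this ⊢; omega))
  refine Nat.sInf_le ⟨_, rfl, by simp, ?_, ?_⟩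
  · intro u hu
    obtain ⟨t, j, rfl⟩ | ⟨t, j, rfl⟩ | ⟨t, rfl⟩ | rfl := vertex_cases u
    · simp [Fin.ext_iff] at hu ⊢
      omega
    · simp at hu ⊢
      simp [hu]
    · simp
    · simp
  · intro w hw
    obtain ⟨t, j, rfl⟩ | ⟨t, j, rfl⟩ | ⟨t, rfl⟩ | rfl := vertex_cases w
    · exact ⟨rim s j, by simp⟩
    · by_cases hj : j = i
      · subst hj
        have ht : t ≠ s := fun h => hw (by rw [h])
        exact ⟨rim s j, by simp [ht, hi]⟩
      · exact ⟨hub s j, by simp [hj]⟩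
    · exact ⟨mid, by simp⟩
    · exact ⟨fork s, by simp⟩

theorem exists_last_iff {v : FkVert k} :
    (∃ p : Fin 4 × Fin k, v = Sum.inl p ∧
        ((p.1 = 1 ∧ (p.2 : ℕ) = k - 1) ∨ (p.1 = 3 ∧ (p.2 : ℕ) = k - 1))) ↔
      ∃ s i, v = rim s i ∧ (i : ℕ) = k - 1 := by
  constructor
  · rintro ⟨⟨_, i⟩, rfl, ⟨rfl, hi⟩ | ⟨rfl, hi⟩⟩
    · exact ⟨false, i, rfl, hi⟩
    · exact ⟨true, i, rfl, hi⟩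
  · rintro ⟨_ | _, i, rfl, hi⟩
    · exact ⟨(1, i), rfl, .inl ⟨rfl, hi⟩⟩
    · exact ⟨(3, i), rfl, .inr ⟨rfl, hi⟩⟩

end FkGraph

/-- For `k ≥ 1` and a vertex `v` of `F_k`: if `v ∈ {b_k, d_k}` then
`γta(F_k; v) < γt(F_k)`; otherwise `γt(F_k − v) < γt(F_k)`. -/
theorem Fk_deleteVert_or_almost (k : ℕ) (hk : 1 ≤ k) (v : FkVert k) :
    ((∃ p : Fin 4 × Fin k, v = Sum.inl p ∧
        ((p.1 = 1 ∧ (p.2 : ℕ) = k - 1) ∨ (p.1 = 3 ∧ (p.2 : ℕ) = k - 1))) →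
      almostTotalDominationNumber (FkGraph k) v < totalDominationNumber (FkGraph k)) ∧
    (¬ (∃ p : Fin 4 × Fin k, v = Sum.inl p ∧
        ((p.1 = 1 ∧ (p.2 : ℕ) = k - 1) ∨ (p.1 = 3 ∧ (p.2 : ℕ) = k - 1))) →
      totalDominationNumber (deleteVert (FkGraph k) v) <
        totalDominationNumber (FkGraph k)) := by
  rw [FkGraph.exists_last_iff]
  refine ⟨?_, fun hv => lt_of_lt_of_le (Nat.lt_succ_of_le ?_) (FkGraph.le_totalDominationNumber k)⟩
  · rintro ⟨s, i, rfl, hi⟩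
    exact lt_of_lt_of_le (Nat.lt_succ_of_le (FkGraph.almostTotalDominationNumber_rim_le s hi))
      (FkGraph.le_totalDominationNumber k)
  · obtain ⟨s, i, rfl⟩ | ⟨s, i, rfl⟩ | ⟨s, rfl⟩ | rfl := FkGraph.vertex_cases v
    · exact FkGraph.deleteVert_hub_le s i
    · exact FkGraph.deleteVert_rim_le s fun hi => hv ⟨s, i, rfl, hi⟩
    · exact FkGraph.deleteVert_fork_le hk s
    · exact FkGraph.deleteVert_mid_le hk
end
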